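/- Let k ≥ 2 be an integer and let C be an orientation of the k-cycle. Then the following two assertions are equivalent: (1) for every ε > 0 there exists a constant c ≥ 1 such that every digraph D without loops or parallel arcs with χ(D) ≥ c and minimum in-degree at least ε·|V(D)| contains C as a subdigraph; (2) C consists of at least three blocks, or C consists of exactly two blocks, both of length at least two. -/

import Mathlib

/-- A digraph `D` (given by its arc relation `E`) contains the digraph given by the
arc relation `F` as a subdigraph: there is an injective map of the vertices preserving arcs. -/
def ContainsDigraph {V W : Type*} (E : V → V → Prop) (F : W → W → Prop) : Prop :=
  ∃ f : W → V, Function.Injective f ∧ ∀ u v : W, F u v → E (f u) (f v)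

/-- The orientation of the `k`-cycle determined by `o : ZMod k → Bool`:
the edge `i` of the cycle joins `i` and `i + 1`, and is oriented `i → i + 1`
when `o i = true`, and `i + 1 → i` when `o i = false`. -/
def cycleOrient {k : ℕ} (o : ZMod k → Bool) : ZMod k → ZMod k → Prop :=
  fun u v => (o u = true ∧ v = u + 1) ∨ (o v = false ∧ u = v + 1)

/-- The arc obtained by orienting the edge `i` of the `k`-cycle according to `o`.
Injectivity of `cycleArc o` says that distinct edges yield distinct arcs, i.e. the
orientation is a genuine digraph without parallel arcs (this is automatic for `k ≥ 3`). -/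
def cycleArc {k : ℕ} (o : ZMod k → Bool) (i : ZMod k) : ZMod k × ZMod k :=
  if o i then (i, i + 1) else (i + 1, i)

open Classical in
/-- The number of blocks of the orientation of the `k`-cycle given by `o`:
a directed cycle has a single block, and otherwise the blocks (maximal directed
subpaths) correspond bijectively to the indices `i` at which the orientation
changes between the consecutive edges `i` and `i + 1`. -/
noncomputable def blockCount {k : ℕ} (o : ZMod k → Bool) : ℕ :=
  if ∀ i, o i = o 0 then 1 else {i : ZMod k | o i ≠ o (i + 1)}.ncard

/-- The orientation of the `k`-cycle given by `o` has a block of length one, i.e.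
some edge `i + 1` is a maximal directed subpath on its own. -/
def hasShortBlock {k : ℕ} (o : ZMod k → Bool) : Prop :=
  ∃ i : ZMod k, o i ≠ o (i + 1) ∧ o (i + 1) ≠ o (i + 2)



section ForwardTools

/-- arc with a prescribed direction -/
def darc {V : Type} (E : V → V → Prop) (b : Bool) (u v : V) : Prop :=
  if b = true then E u v else E v u

/-- `q 0, …, q l` is a path of shape `w`. -/
structure WPath {V : Type} (E : V → V → Prop) (w : ℕ → Bool) (l : ℕ) (q : ℕ → V) : Prop where
  inj : ∀ s t, s ≤ l → t ≤ l → q s = q t → s = t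
  arc : ∀ t, t < l → darc E (w t) (q t) (q (t + 1))

/-- the subdigraph induced on `U` is `c`-colourable -/
def Col {V : Type} (E : V → V → Prop) (U : Set V) (c : ℕ) : Prop :=
  ∃ f : V → ℕ, (∀ v ∈ U, f v < c) ∧ ∀ u ∈ U, ∀ v ∈ U, E u v → f u ≠ f v

lemma Col.mono {V : Type} {E : V → V → Prop} {U U' : Set V} {c c' : ℕ}
    (h : Col E U c) (hU : U' ⊆ U) (hc : c ≤ c') : Col E U' c' := by
  obtain ⟨f, h1, h2⟩ := h
  exact ⟨f, fun v hv => (h1 v (hU hv)).trans_le hc, fun u hu v hv => h2 u (hU hu) v (hU hv)⟩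

open Classical in
lemma Col.union {V : Type} {E : V → V → Prop} {U U' : Set V} {c c' : ℕ}
    (h : Col E U c) (h' : Col E U' c') : Col E (U ∪ U') (c + c') := by
  obtain ⟨f, h1, h2⟩ := h
  obtain ⟨f', h1', h2'⟩ := h'
  refine ⟨fun v => if v ∈ U then f v else c + f' v, ?_, ?_⟩
  · intro v hv
    by_cases hvU : v ∈ U
    · have := h1 v hvU
      simp only [hvU, if_true]; omega
    · have := h1' v (hv.resolve_left hvU)
      simp only [hvU, if_false]; omega
  · intro u hu v hv huv
    by_cases huU : u ∈ U <;> by_cases hvU : v ∈ U <;> simp only [huU, hvU, if_true, if_false]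
    · exact h2 u huU v hvU huv
    · have := h1 u huU; omega
    · have := h1 v hvU; omega
    · have := h2' u (hu.resolve_left huU) v (hv.resolve_left hvU) huv
      omega

lemma Col.finset {V : Type} {E : V → V → Prop} (hE : ∀ v, ¬ E v v) (F : Finset V) :
    Col E (F : Set V) F.card := by
  let e := F.equivFin
  classical
  refine ⟨fun v => if h : v ∈ F then (e ⟨v, h⟩ : ℕ) else 0, ?_, ?_⟩
  · intro v hv
    have hv' : v ∈ F := hv
    simp only [hv', dif_pos]
    exact (e ⟨v, hv'⟩).2
  · intro u hu v hv huv
    have hu' : u ∈ F := hu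
    have hv' : v ∈ F := hv
    simp only [hv', hu', dif_pos]
    intro h
    have := e.injective (Fin.ext h)
    have : u = v := by simpa using this
    subst this
    exact hE u huv

/-- colour classes by types -/
lemma Col.types {V : Type} {E : V → V → Prop} {U : Set V} {K c : ℕ} (τ : V → Fin K)
    (h : ∀ i, Col E {v ∈ U | τ v = i} c) : Col E U (K * c) := by
  choose f h1 h2 using h
  refine ⟨fun v => (τ v : ℕ) * c + f (τ v) v, ?_, ?_⟩
  · intro v hv
    have := h1 (τ v) v ⟨hv, rfl⟩
    have h3 : ((τ v : ℕ) + 1) * c ≤ K * c := Nat.mul_le_mul_right _ (τ v).2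
    simp only; nlinarith
  · intro u hu v hv huv heq
    have hu1 := h1 (τ u) u ⟨hu, rfl⟩
    have hv1 := h1 (τ v) v ⟨hv, rfl⟩
    simp only at heq
    have hc : 0 < c := by omega
    have e1 : ((τ u : ℕ) * c + f (τ u) u) / c = τ u := by
      rw [mul_comm, Nat.mul_add_div hc, Nat.div_eq_of_lt hu1, add_zero]
    have e2 : ((τ v : ℕ) * c + f (τ v) v) / c = τ v := by
      rw [mul_comm, Nat.mul_add_div hc, Nat.div_eq_of_lt hv1, add_zero]
    have hτ : τ u = τ v := Fin.ext (by rw [← e1, ← e2, heq])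
    refine h2 (τ v) u ⟨hu, hτ⟩ v ⟨hv, rfl⟩ huv ?_
    rw [hτ] at heq
    omega

lemma Col.not_diff {V : Type} {E : V → V → Prop} (hE : ∀ v, ¬ E v v) {U : Set V} (F : Finset V)
    {c R : ℕ} (hF : F.card ≤ R) (h : ¬ Col E U (c + R)) : ¬ Col E (U \ F) c := by
  intro h'
  exact h ((h'.union (Col.finset hE F)).mono (by intro x hx; by_cases hxF : x ∈ F <;> simp [hx, hxF])
    (by omega))

open Classical in
lemma col_degenerate {V : Type} {G : V → V → Prop} (hG : ∀ v, ¬ G v v) (d : ℕ)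
    (U : Finset V) (h : ∀ v ∈ U, (U.filter (fun x => G x v)).card ≤ d) :
    Col G (U : Set V) (2 * d + 1) := by
  induction U using Finset.strongInduction with
  | H U ih =>
  rcases U.eq_empty_or_nonempty with rfl | hne
  · exact ⟨fun _ => 0, by simp, by simp⟩
  have hsum : ∑ v ∈ U, (U.filter (fun x => G v x)).card ≤ ∑ v ∈ U, d := by
    have : ∑ v ∈ U, (U.filter (fun x => G v x)).card = ∑ v ∈ U, (U.filter (fun x => G x v)).card := by
      simp only [Finset.card_filter]
      rw [Finset.sum_comm]
    rw [this]
    exact Finset.sum_le_sum h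
  obtain ⟨v, hv, hvd⟩ := Finset.exists_le_of_sum_le hne hsum
  obtain ⟨f, h1, h2⟩ := ih (U.erase v) (Finset.erase_ssubset hv) (by
    intro x hx
    refine le_trans (Finset.card_le_card ?_) (h x (Finset.mem_of_mem_erase hx))
    exact Finset.filter_subset_filter _ (Finset.erase_subset _ _))
  let B := (U.filter (fun x => G v x) ∪ U.filter (fun x => G x v)).image f
  have hB : B.card ≤ 2 * d := by
    refine Finset.card_image_le.trans ((Finset.card_union_le _ _).trans ?_)
    have := h v hv
    omega
  obtain ⟨c, hc, hcB⟩ : ∃ c ∈ Finset.range (2 * d + 1), c ∉ B := by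
    by_contra hcon
    push Not at hcon
    have := Finset.card_le_card (show Finset.range (2 * d + 1) ⊆ B from hcon)
    simp at this
    omega
  have hcB' : ∀ x ∈ U, (G v x ∨ G x v) → f x ≠ c := by
    intro x hx hor heq
    apply hcB
    refine Finset.mem_image.2 ⟨x, ?_, heq⟩
    rcases hor with h | h <;> simp [hx, h]
  refine ⟨fun x => if x = v then c else f x, ?_, ?_⟩
  · intro x hx
    by_cases hxv : x = v
    · simpa [hxv] using hc
    · simp only [hxv, if_false]
      exact h1 x (by simpa [hxv] using hx)
  · intro x hx y hy hxy
    by_cases hxv : x = v <;> by_cases hyv : y = v <;> simp only [hxv, hyv, if_true, if_false]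
    · subst hxv; subst hyv; exact absurd hxy (hG _)
    · subst hxv; exact (hcB' y hy (Or.inl hxy)).symm
    · subst hyv; exact hcB' x hx (Or.inr hxy)
    · exact h2 x (by simpa [hxv] using hx) y (by simpa [hyv] using hy) hxy

/-- vertices of `U` not starting a path of shape `w` inside `U` -/
def NoStart {V : Type} (E : V → V → Prop) (w : ℕ → Bool) (l : ℕ) (U : Set V) : Set V :=
  {v ∈ U | ¬ ∃ q, WPath E w l q ∧ q 0 = v ∧ ∀ t ≤ l, q t ∈ U}

open Classical in
lemma noStart_col (l : ℕ) : ∃ c : ℕ, ∀ (w : ℕ → Bool) (V : Type) [Fintype V] (E : V → V → Prop)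
    (_ : ∀ v, ¬ E v v) (U : Set V), Col E (NoStart E w l U) c := by
  induction l with
  | zero =>
    refine ⟨0, ?_⟩
    intro w V _ E hE U
    refine ⟨fun _ => 0, ?_, ?_⟩
    · intro v hv
      exact absurd ⟨fun _ => v, ⟨by intros; omega, by intros; omega⟩, rfl, fun _ _ => hv.1⟩ hv.2
    · intro v hv
      exact absurd ⟨fun _ => v, ⟨by intros; omega, by intros; omega⟩, rfl, fun _ _ => hv.1⟩ hv.2
  | succ l ih =>
    obtain ⟨c, hc⟩ := ih
    refine ⟨c + (2 * (l + 1) + 1), ?_⟩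
    intro w V _ E hE U
    set Z := NoStart E w (l + 1) U with hZ
    set Z' := NoStart E (fun t => w (t + 1)) l Z with hZ'
    have h1 : Col E Z' c := hc _ V E hE Z
    have h2 : Col (darc E (w 0)) ((Z \ Z').toFinset : Set V) (2 * (l + 1) + 1) := by
      apply col_degenerate
      · intro v hv
        unfold darc at hv
        split_ifs at hv <;> exact hE v hv
      · intro v hv
        have hv' : v ∈ Z ∧ v ∉ Z' := by simpa using hv
        have : ∃ q, WPath E (fun t => w (t + 1)) l q ∧ q 0 = v ∧ ∀ t ≤ l, q t ∈ Z := by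
          by_contra hcon
          exact hv'.2 ⟨hv'.1, hcon⟩
        obtain ⟨q, hq, hq0, hqZ⟩ := this
        refine le_trans (Finset.card_le_card (t := (Finset.range (l + 1)).image q) ?_)
          (Finset.card_image_le.trans (by simp))
        intro x hx
        have hx' : (x ∈ Z ∧ x ∉ Z') ∧ darc E (w 0) x v := by simpa using hx
        by_contra hxq
        have hxq' : ∀ t ≤ l, q t ≠ x := by
          intro t ht heq
          exact hxq (Finset.mem_image.2 ⟨t, by simp; omega, heq⟩)
        refine hx'.1.1.2 ⟨fun t => if t = 0 then x else q (t - 1), ⟨?_, ?_⟩, by simp, ?_⟩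
        · intro s t hs ht hst
          by_cases hs0 : s = 0 <;> by_cases ht0 : t = 0 <;>
            simp only [hs0, ht0, if_true, if_false] at hst ⊢
          · exact absurd hst.symm (hxq' _ (by omega))
          · exact absurd hst (hxq' _ (by omega))
          · have := hq.inj _ _ (by omega) (by omega) hst
            omega
        · intro t ht
          by_cases ht0 : t = 0
          · subst ht0
            simpa [hq0] using hx'.2
          · have := hq.arc (t - 1) (by omega)
            have e : t - 1 + 1 = t := by omega
            simp only [e] at this
            simpa [ht0] using this
        · intro t ht
          by_cases ht0 : t = 0
          · simpa [ht0] using hx'.1.1.1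
          · simpa [ht0] using (hqZ (t - 1) (by omega)).1
    have h3 : Col E (Z \ Z') (2 * (l + 1) + 1) := by
      obtain ⟨f, g1, g2⟩ := h2
      refine ⟨f, fun v hv => g1 v (by simpa using hv), fun u hu v hv huv => ?_⟩
      cases hw : w 0
      · exact (g2 v (by simpa using hv) u (by simpa using hu) (by simpa [darc, hw] using huv)).symm
      · exact g2 u (by simpa using hu) v (by simpa using hv) (by simpa [darc, hw] using huv)
    refine (h1.union h3).mono ?_ le_rfl
    intro x hx
    by_cases h : x ∈ Z'
    · exact Or.inl h
    · exact Or.inr ⟨hx, h⟩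

end ForwardTools


section CompactTools

lemma exists_orthonormal_cut {H : Type} [NormedAddCommGroup H] [InnerProductSpace ℝ H]
    {ι : Type} [Fintype ι] (m : ι → H) (B δ : ℝ) (hB : 0 < B) (hδ : 0 < δ)
    (hm : ∑ a, ‖m a‖ ^ 2 ≤ B) :
    ∃ (s : ℕ) (g : Fin s → H), (s : ℝ) ≤ 1 / δ ∧ Orthonormal ℝ g ∧
      ∀ d : H, (∀ i, inner ℝ (g i) d = 0) → ∑ a, (inner ℝ (m a) d) ^ 2 ≤ δ * B * ‖d‖ ^ 2 := by
  classical
  let P : ℕ → Prop := fun s => ∃ g : Fin s → H, Orthonormal ℝ g ∧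
    ∀ i, δ * B ≤ ∑ a, (inner ℝ (m a) (g i)) ^ 2
  have hP : ∀ s, P s → (s : ℝ) ≤ 1 / δ := by
    rintro s ⟨g, hg, hgm⟩
    have h1 : (s : ℝ) * (δ * B) ≤ ∑ i : Fin s, ∑ a, (inner ℝ (m a) (g i)) ^ 2 := by
      have := Finset.card_nsmul_le_sum (Finset.univ : Finset (Fin s)) _ _ (fun i _ => hgm i)
      simpa using this
    rw [Finset.sum_comm] at h1
    have h2 : ∑ a, ∑ i : Fin s, (inner ℝ (m a) (g i)) ^ 2 ≤ ∑ a, ‖m a‖ ^ 2 := by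
      refine Finset.sum_le_sum fun a _ => ?_
      have := hg.sum_inner_products_le (m a) (s := Finset.univ)
      refine le_trans (le_of_eq ?_) this
      refine Finset.sum_congr rfl fun i _ => ?_
      rw [real_inner_comm, Real.norm_eq_abs, sq_abs]
    have h3 : (s : ℝ) * (δ * B) ≤ B := h1.trans (h2.trans hm)
    rw [le_div_iff₀ hδ]
    nlinarith
  have h0 : P 0 := ⟨Fin.elim0, ⟨fun i => i.elim0, fun i => i.elim0⟩, fun i => i.elim0⟩
  have hex : ∃ s, ¬ P s := by
    refine ⟨⌊1 / δ⌋₊ + 1, fun h => ?_⟩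
    have := hP _ h
    have h2 := Nat.lt_floor_add_one (1 / δ)
    push_cast at this
    linarith
  obtain ⟨s, hs, hs1⟩ : ∃ s, P s ∧ ¬ P (s + 1) := by
    by_contra hcon
    push Not at hcon
    obtain ⟨s, hs⟩ := hex
    apply hs
    clear hs
    induction s with
    | zero => exact h0
    | succ s ih => exact hcon s ih
  obtain ⟨g, hg, hgm⟩ := hs
  refine ⟨s, g, hP s ⟨g, hg, hgm⟩, hg, ?_⟩
  intro d hd
  by_contra hcon
  push Not at hcon
  have hd0 : d ≠ 0 := by
    rintro rfl
    simp at hcon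
  have hdn : 0 < ‖d‖ := norm_pos_iff.2 hd0
  apply hs1
  refine ⟨Fin.snoc (α := fun _ => H) g ((‖d‖)⁻¹ • d), ?_, ?_⟩
  · constructor
    · intro i
      refine Fin.lastCases ?_ (fun j => ?_) i
      · simp [norm_smul, hdn.ne']
      · simpa using hg.1 j
    · intro i j hij
      revert hij
      refine Fin.lastCases ?_ (fun i => ?_) i
      · refine Fin.lastCases ?_ (fun j => ?_) j
        · intro h; exact absurd rfl h
        · intro _
          simp [inner_smul_left]
          right
          rw [real_inner_comm]; exact hd j
      · refine Fin.lastCases ?_ (fun j => ?_) j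
        · intro _
          simp [inner_smul_right, hd i]
        · intro h
          simp only [Fin.snoc_castSucc]
          exact hg.2 (fun h' => h (by rw [h']))
  · intro i
    refine Fin.lastCases ?_ (fun j => ?_) i
    · simp only [Fin.snoc_last, inner_smul_right, mul_pow]
      rw [← Finset.mul_sum, inv_pow, inv_mul_eq_div, le_div_iff₀ (by positivity)]
      exact hcon.le
    · simpa using hgm j

lemma compact_types (η : ℝ) (hη : 0 < η) : ∃ K : ℕ, ∀ (n : ℕ) (M : Fin n → Fin n → ℝ)
    (_ : ∀ a b, |M a b| ≤ 1),
    ∃ τ : Finset (Fin n) → Fin K, ∀ X Y Z : Finset (Fin n), τ X = τ Y →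
      |∑ a ∈ Z, ∑ b ∈ X, M a b - ∑ a ∈ Z, ∑ b ∈ Y, M a b| ≤ η * (n : ℝ) ^ 2 := by
  classical
  set δ : ℝ := (η / 2) ^ 2 with hδd
  have hδ : 0 < δ := by positivity
  set r : ℝ := δ * (η / 2) with hrd
  have hr : 0 < r := by positivity
  set R : ℕ := ⌈1 / r⌉₊ with hR
  set S : ℕ := ⌊1 / δ⌋₊ with hS
  refine ⟨(2 * R + 3) ^ S, ?_⟩
  intro n M hM
  rcases Nat.eq_zero_or_pos n with rfl | hn
  · refine ⟨fun _ => ⟨0, by positivity⟩, ?_⟩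
    intro X Y Z _
    have : Z = ∅ := Finset.eq_empty_of_isEmpty Z
    simp [this]
  have hn' : (0 : ℝ) < n := by exact_mod_cast hn
  let H := EuclideanSpace ℝ (Fin n)
  let m : Fin n → H := fun a => WithLp.toLp 2 (fun b => M a b)
  let ind : Finset (Fin n) → H := fun X => WithLp.toLp 2 (fun b => if b ∈ X then (1 : ℝ) else 0)
  have hmn : ∀ a, ‖m a‖ ^ 2 ≤ n := by
    intro a
    rw [EuclideanSpace.norm_sq_eq]
    calc ∑ b, ‖(m a) b‖ ^ 2 ≤ ∑ b : Fin n, (1 : ℝ) := by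
          refine Finset.sum_le_sum fun b _ => ?_
          have := hM a b
          have h2 : ‖(m a) b‖ = |M a b| := rfl
          rw [h2]
          have := abs_nonneg (M a b)
          nlinarith
      _ = n := by simp
  have hindn : ∀ X Y, ‖ind X - ind Y‖ ^ 2 ≤ n := by
    intro X Y
    rw [EuclideanSpace.norm_sq_eq]
    calc ∑ b, ‖(ind X - ind Y) b‖ ^ 2 ≤ ∑ b : Fin n, (1 : ℝ) := by
          refine Finset.sum_le_sum fun b _ => ?_
          have h2 : (ind X - ind Y) b = (if b ∈ X then (1 : ℝ) else 0) - (if b ∈ Y then (1 : ℝ) else 0) := rfl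
          rw [h2]
          split_ifs <;> simp
      _ = n := by simp
  have hindn1 : ∀ X, ‖ind X‖ ≤ √n := by
    intro X
    have h0 : ind ∅ = 0 := by
      ext b
      simp [ind]
    have := hindn X ∅
    rw [h0, sub_zero] at this
    exact Real.le_sqrt_of_sq_le this
  have hinner : ∀ a X, inner ℝ (m a) (ind X) = ∑ b ∈ X, M a b := by
    intro a X
    have h1 : inner ℝ (m a) (ind X) =
        ∑ b, inner ℝ (M a b) (if b ∈ X then (1 : ℝ) else 0) := PiLp.inner_apply _ _
    rw [h1]
    simp [Finset.sum_ite_mem]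
  obtain ⟨s, g, hs, hg, hcut⟩ := exists_orthonormal_cut m ((n : ℝ) ^ 2) δ (by positivity) hδ (by
    calc ∑ a, ‖m a‖ ^ 2 ≤ ∑ a : Fin n, (n : ℝ) := Finset.sum_le_sum fun a _ => hmn a
      _ = (n : ℝ) ^ 2 := by simp [sq])
  have hsS : s ≤ S := Nat.le_floor hs
  have hsn : 0 < √(n : ℝ) := Real.sqrt_pos.2 hn'
  have hrn : 0 < r * √n := by positivity
  -- the rounding
  let fl : Finset (Fin n) → Fin s → ℤ := fun X i => ⌊inner ℝ (g i) (ind X) / (r * √n)⌋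
  have hbd : ∀ X i, |inner ℝ (g i) (ind X) / (r * √n)| ≤ R := by
    intro X i
    have h1 : |inner ℝ (g i) (ind X)| ≤ √n := by
      refine (abs_real_inner_le_norm _ _).trans ?_
      rw [hg.1 i, one_mul]
      exact hindn1 X
    rw [abs_div, abs_of_pos hrn, div_le_iff₀ hrn]
    have h2 : 1 / r ≤ (R : ℝ) := Nat.le_ceil _
    rw [div_le_iff₀ hr] at h2
    nlinarith
  let q : Finset (Fin n) → Fin s → Fin (2 * R + 3) := fun X i =>
    ⟨(fl X i + R + 1).toNat, by
      have h1 := abs_le.1 (hbd X i)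
      have h2 : fl X i ≤ (R : ℤ) := by
        have : (fl X i : ℝ) ≤ R := (Int.floor_le _).trans h1.2
        exact_mod_cast this
      omega⟩
  have hq : ∀ X Y i, q X i = q Y i → fl X i = fl Y i := by
    intro X Y i h
    have hlow : ∀ X, -(R : ℤ) ≤ fl X i := by
      intro X
      have h1 := abs_le.1 (hbd X i)
      exact Int.le_floor.2 (by push_cast; exact h1.1)
    have h1 := hlow X
    have h2 := hlow Y
    have h3 := congrArg Fin.val h
    simp only [q] at h3
    omega
  obtain ⟨emb⟩ : Nonempty ((Fin s → Fin (2 * R + 3)) ↪ Fin ((2 * R + 3) ^ S)) := by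
    apply Function.Embedding.nonempty_of_card_le
    simp only [Fintype.card_pi, Fintype.card_fin, Finset.prod_const, Finset.card_univ]
    exact Nat.pow_le_pow_right (by omega) hsS
  refine ⟨fun X => emb (q X), ?_⟩
  intro X Y Z hXY
  have hqXY := emb.injective hXY
  set d : H := ind X - ind Y with hd
  have hc : ∀ i, |inner ℝ (g i) d| ≤ r * √n := by
    intro i
    have h1 := hq X Y i (congrFun hqXY i)
    have h2 := Int.abs_sub_lt_one_of_floor_eq_floor h1
    rw [← sub_div, abs_div, abs_of_pos hrn, div_lt_one hrn] at h2
    rw [hd, inner_sub_right]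
    exact h2.le
  set e : H := ∑ i, (inner ℝ (g i) d : ℝ) • g i with he
  have horth : ∀ i, inner ℝ (g i) (d - e) = 0 := by
    intro i
    rw [inner_sub_right, he, hg.inner_right_fintype]
    simp
  have hde : ‖d - e‖ ^ 2 ≤ n := by
    have h1 : inner ℝ e (d - e) = 0 := by
      rw [he, sum_inner]
      refine Finset.sum_eq_zero fun i _ => ?_
      rw [inner_smul_left, horth i, mul_zero]
    have h2 : ‖d‖ ^ 2 = ‖e‖ ^ 2 + ‖d - e‖ ^ 2 := by
      have := norm_add_sq_eq_norm_sq_add_norm_sq_of_inner_eq_zero e (d - e) h1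
      rw [add_sub_cancel] at this
      nlinarith
    have := hindn X Y
    rw [← hd, h2] at this
    have := sq_nonneg ‖e‖
    linarith
  have hcut' := hcut (d - e) horth
  -- sum over Z
  have hsum : ∑ a ∈ Z, ∑ b ∈ X, M a b - ∑ a ∈ Z, ∑ b ∈ Y, M a b
      = ∑ a ∈ Z, inner ℝ (m a) e + ∑ a ∈ Z, inner ℝ (m a) (d - e) := by
    rw [← Finset.sum_add_distrib, ← Finset.sum_sub_distrib]
    refine Finset.sum_congr rfl fun a _ => ?_
    rw [← inner_add_right, add_sub_cancel, hd, inner_sub_right, hinner, hinner]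
  have hZn : (Z.card : ℝ) ≤ n := by
    exact_mod_cast (Finset.card_le_univ Z).trans (by simp)
  have hb1 : |∑ a ∈ Z, inner ℝ (m a) e| ≤ η / 2 * (n : ℝ) ^ 2 := by
    have hone : ∀ a, |inner ℝ (m a) e| ≤ η / 2 * n := by
      intro a
      refine (abs_real_inner_le_norm _ _).trans ?_
      have h1 : ‖m a‖ ≤ √n := Real.le_sqrt_of_sq_le (hmn a)
      have h2 : ‖e‖ ≤ s * (r * √n) := by
        refine (norm_sum_le _ _).trans ?_
        calc ∑ i, ‖(inner ℝ (g i) d : ℝ) • g i‖ ≤ ∑ i : Fin s, r * √n := by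
              refine Finset.sum_le_sum fun i _ => ?_
              rw [norm_smul, hg.1 i, mul_one]
              exact hc i
          _ = s * (r * √n) := by simp
      have h3 : (s : ℝ) * r ≤ η / 2 := by
        rw [le_div_iff₀ hδ] at hs
        rw [hrd]
        nlinarith
      calc ‖m a‖ * ‖e‖ ≤ √n * (s * (r * √n)) := by gcongr
        _ = (s * r) * (√n * √n) := by ring
        _ = (s * r) * n := by rw [Real.mul_self_sqrt hn'.le]
        _ ≤ η / 2 * n := by gcongr
    calc |∑ a ∈ Z, inner ℝ (m a) e| ≤ ∑ a ∈ Z, |inner ℝ (m a) e| := Finset.abs_sum_le_sum_abs _ _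
      _ ≤ ∑ a ∈ Z, η / 2 * n := Finset.sum_le_sum fun a _ => hone a
      _ = Z.card * (η / 2 * n) := by simp
      _ ≤ n * (η / 2 * n) := by gcongr
      _ = _ := by ring
  have hb2 : |∑ a ∈ Z, inner ℝ (m a) (d - e)| ≤ η / 2 * (n : ℝ) ^ 2 := by
    have h1 := sq_sum_le_card_mul_sum_sq (s := Z) (f := fun a => (inner ℝ (m a) (d - e) : ℝ))
    have h2 : ∑ a ∈ Z, (inner ℝ (m a) (d - e) : ℝ) ^ 2 ≤ ∑ a, (inner ℝ (m a) (d - e) : ℝ) ^ 2 :=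
      Finset.sum_le_sum_of_subset_of_nonneg (Finset.subset_univ _) (fun _ _ _ => sq_nonneg _)
    apply abs_le_of_sq_le_sq _ (by positivity)
    calc (∑ a ∈ Z, (inner ℝ (m a) (d - e) : ℝ)) ^ 2
        ≤ Z.card * ∑ a ∈ Z, (inner ℝ (m a) (d - e) : ℝ) ^ 2 := h1
      _ ≤ n * (δ * (n : ℝ) ^ 2 * n) := by
          gcongr
          exact h2.trans (hcut'.trans (by gcongr))
      _ = (η / 2 * (n : ℝ) ^ 2) ^ 2 := by rw [hδd]; ring
  rw [hsum]
  refine (abs_add_le _ _).trans ?_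
  linarith

end CompactTools


section MainTools

/-- in-neighbourhood as a finset -/
noncomputable def inN {n : ℕ} (E : Fin n → Fin n → Prop) (z : Fin n) : Finset (Fin n) := by
  classical
  exact Finset.univ.filter (fun u => E u z)

lemma mem_inN {n : ℕ} {E : Fin n → Fin n → Prop} {z u : Fin n} : u ∈ inN E z ↔ E u z := by
  simp [inN]

/-- `a` and `b` are joined robustly by paths of shape `w` between their out-neighbourhoods. -/
def Conn {n : ℕ} (E : Fin n → Fin n → Prop) (w : ℕ → Bool) (l L : ℕ) (a a' : Fin n) : Prop :=
  ∀ F : Finset (Fin n), F.card ≤ L →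
    ∃ q, WPath E w l q ∧ E a (q 0) ∧ E a' (q l) ∧ ∀ t ≤ l, q t ∉ F

open Classical in
lemma robust (w : ℕ → Bool) (l L : ℕ) (η : ℝ) (hη : 0 < η) : ∃ R : ℕ, ∀ (n : ℕ)
    (E : Fin n → Fin n → Prop), ∃ F : Finset (Fin n), F.card ≤ R ∧
      ∀ q, WPath E w l q → (∀ t ≤ l, q t ∉ F) →
        (((inN E (q 0) ×ˢ inN E (q l)).filter (fun p => ¬ Conn E w l L p.1 p.2)).card : ℝ)
          ≤ η * (n : ℝ) ^ 2 := by
  refine ⟨⌊L / η⌋₊ * (l + 1), ?_⟩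
  intro n E
  rcases Nat.eq_zero_or_pos n with rfl | hn
  · exact ⟨∅, by simp, fun q => (q 0).elim0⟩
  have hn' : (0 : ℝ) < n := by exact_mod_cast hn
  let B : (ℕ → Fin n) → Finset (Fin n × Fin n) := fun q =>
    (inN E (q 0) ×ˢ inN E (q l)).filter (fun p => ¬ Conn E w l L p.1 p.2)
  let bad : Finset (Fin n) → Prop := fun s => ∃ q, WPath E w l q ∧
    s = (Finset.range (l + 1)).image q ∧ η * (n : ℝ) ^ 2 < (B q).card
  let good : Finset (Finset (Fin n)) → Prop := fun A =>
    (∀ s ∈ A, bad s) ∧ ∀ s ∈ A, ∀ t ∈ A, s ≠ t → Disjoint s t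
  obtain ⟨A, hA, hmax⟩ := Finset.exists_max_image
    (Finset.univ.filter (fun A => good A)) Finset.card ⟨∅, by simp [good]⟩
  have hA' : good A := by simpa using hA
  have hmax' : ∀ A', good A' → A'.card ≤ A.card := fun A' h => hmax A' (by simpa using h)
  refine ⟨A.biUnion id, ?_, ?_⟩
  · have hcard : A.card ≤ ⌊L / η⌋₊ := by
      apply Nat.le_floor
      rw [le_div_iff₀ hη]
      have hQ : ∀ s, ∃ q, s ∈ A → WPath E w l q ∧
          s = (Finset.range (l + 1)).image q ∧ η * (n : ℝ) ^ 2 < (B q).card := by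
        intro s
        by_cases hs : s ∈ A
        · obtain ⟨q, hq⟩ := hA'.1 s hs
          exact ⟨q, fun _ => hq⟩
        · exact ⟨fun _ => ⟨0, hn⟩, fun h => absurd h hs⟩
      choose Q hQ using hQ
      have h1 : (A.card : ℝ) * (η * (n : ℝ) ^ 2) ≤ ∑ s ∈ A, ((B (Q s)).card : ℝ) := by
        rw [← nsmul_eq_mul]
        exact Finset.card_nsmul_le_sum _ _ _ (fun s hs => (hQ s hs).2.2.le)
      have h2 : ∑ s ∈ A, (B (Q s)).card ≤ ∑ _p : Fin n × Fin n, L := by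
        have : ∀ s ∈ A, (B (Q s)).card = ∑ p : Fin n × Fin n, if p ∈ B (Q s) then 1 else 0 := by
          intro s _
          simp
        rw [Finset.sum_congr rfl this, Finset.sum_comm]
        refine Finset.sum_le_sum fun p _ => ?_
        rw [← Finset.card_filter]
        by_cases hp : Conn E w l L p.1 p.2
        · have : A.filter (fun s => p ∈ B (Q s)) = ∅ := by
            apply Finset.filter_eq_empty_iff.2
            intro s _ h
            simp only [B, Finset.mem_filter] at h
            exact h.2 hp
          rw [this]; simp
        · unfold Conn at hp
          push Not at hp
          obtain ⟨F, hFL, hF⟩ := hp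
          refine le_trans ?_ hFL
          have hx : ∀ s, ∃ x, s ∈ A.filter (fun s => p ∈ B (Q s)) → x ∈ s ∧ x ∈ F := by
            intro s
            by_cases hs : s ∈ A.filter (fun s => p ∈ B (Q s))
            · rw [Finset.mem_filter] at hs
              have h3 := hs.2
              simp only [B, Finset.mem_filter, Finset.mem_product, mem_inN] at h3
              obtain ⟨h4, h5, h6⟩ := hQ s hs.1
              obtain ⟨t, ht, htF⟩ := hF _ h4 h3.1.1 h3.1.2
              refine ⟨Q s t, fun _ => ⟨?_, htF⟩⟩
              exact (Finset.ext_iff.1 h5 _).2 (Finset.mem_image.2 ⟨t, by simp; omega, rfl⟩)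
            · exact ⟨⟨0, hn⟩, fun h => absurd h hs⟩
          choose x hx using hx
          refine Finset.card_le_card_of_injOn x (fun s hs => (hx s hs).2) ?_
          intro s hs t ht hst
          by_contra hne
          have hs' := (Finset.mem_filter.1 hs).1
          have ht' := (Finset.mem_filter.1 ht).1
          have hdis := hA'.2 s hs' t ht' hne
          have hsx := (hx s hs).1
          rw [hst] at hsx
          exact Finset.disjoint_left.1 hdis hsx (hx t ht).1
      have h3 : ∑ s ∈ A, ((B (Q s)).card : ℝ) ≤ (n : ℝ) ^ 2 * L := by
        have : ((∑ s ∈ A, (B (Q s)).card : ℕ) : ℝ) ≤ ((∑ _p : Fin n × Fin n, L : ℕ) : ℝ) := by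
          exact_mod_cast h2
        rw [Nat.cast_sum] at this
        refine this.trans (le_of_eq ?_)
        simp [sq]
      have h4 := h1.trans h3
      have h5 : (0 : ℝ) < (n : ℝ) ^ 2 := by positivity
      have h6 : (n : ℝ) ^ 2 * (A.card * η) ≤ (n : ℝ) ^ 2 * L := by linarith
      exact le_of_mul_le_mul_left h6 h5
    have : (A.biUnion id).card ≤ A.card * (l + 1) := by
      apply Finset.card_biUnion_le_card_mul
      intro s hs
      obtain ⟨q, _, h, _⟩ := hA'.1 s hs
      simp only [id]
      rw [h]
      exact Finset.card_image_le.trans (by simp)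
    exact this.trans (Nat.mul_le_mul_right _ hcard)
  · intro q hq hqF
    by_contra hcon
    push Not at hcon
    set s := (Finset.range (l + 1)).image q with hs
    have hq0s : q 0 ∈ s := Finset.mem_image.2 ⟨0, by simp, rfl⟩
    have hdisj : ∀ t ∈ A, Disjoint s t := by
      intro t ht
      rw [Finset.disjoint_left]
      intro x hxs hxt
      obtain ⟨j, hj, rfl⟩ := Finset.mem_image.1 hxs
      refine hqF j (by simp at hj; omega) (Finset.mem_biUnion.2 ⟨t, ht, hxt⟩)
    have hsA : s ∉ A := fun h => Finset.disjoint_left.1 (hdisj s h) hq0s hq0s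
    have := hmax' (insert s A) ⟨?_, ?_⟩
    · rw [Finset.card_insert_of_notMem hsA] at this
      omega
    · intro t ht
      rcases Finset.mem_insert.1 ht with rfl | ht
      · exact ⟨q, hq, hs, hcon⟩
      · exact hA'.1 t ht
    · intro t ht t' ht' hne
      rcases Finset.mem_insert.1 ht with rfl | ht <;> rcases Finset.mem_insert.1 ht' with rfl | ht'
      · exact absurd rfl hne
      · exact hdisj _ ht'
      · exact (hdisj _ ht).symm
      · exact hA'.2 t ht t' ht' hne

open Classical in
lemma conn_count {n : ℕ} (E : Fin n → Fin n → Prop) (w : ℕ → Bool) (l L : ℕ)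
    (X Y : Finset (Fin n)) :
    (((X ×ˢ Y).filter (fun p => ¬ Conn E w l L p.1 p.2)).card : ℝ)
      = ∑ a ∈ X, ∑ b ∈ Y, if Conn E w l L a b then (0 : ℝ) else 1 := by
  rw [Finset.card_filter, Finset.sum_product]
  push_cast
  refine Finset.sum_congr rfl fun a _ => Finset.sum_congr rfl fun b _ => ?_
  by_cases h : Conn E w l L a b
  · rw [if_pos h, if_neg (not_not.2 h)]
  · rw [if_neg h, if_pos h]

set_option maxHeartbeats 1000000 in
open Classical in
lemma beta_main (ε : ℝ) (hε : 0 < ε) (l₁ l₂ : ℕ) (w₁ w₂ : ℕ → Bool) : ∃ c : ℕ, ∀ (n : ℕ)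
    (E : Fin n → Fin n → Prop), (∀ v, ¬ E v v) → (∀ z, ε * n ≤ ((inN E z).card : ℝ)) →
    ¬ Col E Set.univ c →
    ∃ a a' q₁ q₂, a ≠ a' ∧ WPath E w₁ l₁ q₁ ∧ WPath E w₂ l₂ q₂ ∧ E a (q₁ 0) ∧ E a' (q₁ l₁) ∧
      E a' (q₂ 0) ∧ E a (q₂ l₂) ∧ (∀ t ≤ l₁, q₁ t ≠ a ∧ q₁ t ≠ a') ∧
      (∀ t ≤ l₂, q₂ t ≠ a ∧ q₂ t ≠ a') ∧ ∀ s ≤ l₁, ∀ t ≤ l₂, q₁ s ≠ q₂ t := by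
  set η : ℝ := ε ^ 2 / 16 with hηd
  have hη : 0 < η := by positivity
  set L : ℕ := l₁ + 3 with hL
  obtain ⟨R₁, hR₁⟩ := robust w₁ l₁ L η hη
  obtain ⟨R₂, hR₂⟩ := robust w₂ l₂ L η hη
  obtain ⟨K, hK⟩ := compact_types η hη
  obtain ⟨c₁, hc₁⟩ := noStart_col l₁
  obtain ⟨c₂, hc₂⟩ := noStart_col l₂
  refine ⟨(K * (K * (c₁ + c₂)) + (R₁ + R₂)) + ⌈2 / ε ^ 2⌉₊, ?_⟩
  intro n E hE hdeg hcol
  -- `n` is large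
  have hnbig : 2 / ε ^ 2 < n := by
    by_contra hcon
    push Not at hcon
    apply hcol
    have h1 : n ≤ ⌈2 / ε ^ 2⌉₊ := by
      have := hcon.trans (Nat.le_ceil _)
      exact_mod_cast this
    refine (Col.finset hE (Finset.univ : Finset (Fin n))).mono (by simp) ?_
    simp; omega
  have hn' : (0 : ℝ) < n := lt_trans (by positivity) hnbig
  obtain ⟨F₁, hF₁, hG₁⟩ := hR₁ n E
  obtain ⟨F₂, hF₂, hG₂⟩ := hR₂ n E
  have hcol1 : ¬ Col E (Set.univ \ ((F₁ ∪ F₂ : Finset (Fin n)) : Set (Fin n)))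
      (K * (K * (c₁ + c₂))) := by
    apply Col.not_diff hE (F₁ ∪ F₂) (R := R₁ + R₂)
    · exact (Finset.card_union_le _ _).trans (by omega)
    · exact fun h => hcol (h.mono le_rfl (by omega))
  let M₁ : Fin n → Fin n → ℝ := fun a b => if Conn E w₁ l₁ L a b then 0 else 1
  let M₂ : Fin n → Fin n → ℝ := fun a b => if Conn E w₂ l₂ L a b then 0 else 1
  obtain ⟨τ₁, hτ₁⟩ := hK n M₁ (by intro a b; simp only [M₁]; split_ifs <;> simp)
  obtain ⟨τ₂, hτ₂⟩ := hK n M₂ (by intro a b; simp only [M₂]; split_ifs <;> simp)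
  obtain ⟨i, j, hcol2⟩ : ∃ i j, ¬ Col E {v ∈ {v ∈ Set.univ \ ((F₁ ∪ F₂ : Finset (Fin n)) : Set (Fin n))
      | τ₁ (inN E v) = i} | τ₂ (inN E v) = j} (c₁ + c₂) := by
    by_contra hcon
    push Not at hcon
    exact hcol1 (Col.types (fun v => τ₁ (inN E v)) fun i =>
      Col.types (fun v => τ₂ (inN E v)) fun j => hcon i j)
  set U := {v ∈ {v ∈ Set.univ \ ((F₁ ∪ F₂ : Finset (Fin n)) : Set (Fin n))
      | τ₁ (inN E v) = i} | τ₂ (inN E v) = j} with hU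
  have hUF : ∀ v ∈ U, v ∉ F₁ ∧ v ∉ F₂ ∧ τ₁ (inN E v) = i ∧ τ₂ (inN E v) = j := by
    intro v hv
    simp [hU] at hv
    tauto
  obtain ⟨z, hzU, hz1, hz2⟩ : ∃ z ∈ U, z ∉ NoStart E w₁ l₁ U ∧ z ∉ NoStart E w₂ l₂ U := by
    by_contra hcon
    push Not at hcon
    refine hcol2 (((hc₁ w₁ _ E hE U).union (hc₂ w₂ _ E hE U)).mono ?_ le_rfl)
    intro z hz
    by_cases h : z ∈ NoStart E w₁ l₁ U
    · exact Or.inl h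
    · exact Or.inr (hcon z hz h)
  have hp1 : ∃ q, WPath E w₁ l₁ q ∧ q 0 = z ∧ ∀ t ≤ l₁, q t ∈ U := by
    by_contra hcon
    exact hz1 ⟨hzU, hcon⟩
  have hp2 : ∃ q, WPath E w₂ l₂ q ∧ q 0 = z ∧ ∀ t ≤ l₂, q t ∈ U := by
    by_contra hcon
    exact hz2 ⟨hzU, hcon⟩
  obtain ⟨p₁, hp₁, hp₁0, hp₁U⟩ := hp1
  obtain ⟨p₂, hp₂, hp₂0, hp₂U⟩ := hp2
  have key := fun w l X Y => conn_count E w l L X Y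
  have b1 := hG₁ p₁ hp₁ (fun t ht => (hUF _ (hp₁U t ht)).1)
  have b2 := hG₂ p₂ hp₂ (fun t ht => (hUF _ (hp₂U t ht)).2.1)
  rw [hp₁0] at b1
  rw [hp₂0] at b2
  set Z := inN E z with hZ
  have d1 := hτ₁ Z (inN E (p₁ l₁)) Z
    ((hUF z hzU).2.2.1.trans (hUF _ (hp₁U l₁ le_rfl)).2.2.1.symm)
  have d2 := hτ₂ Z (inN E (p₂ l₂)) Z
    ((hUF z hzU).2.2.2.trans (hUF _ (hp₂U l₂ le_rfl)).2.2.2.symm)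
  simp only [M₁, M₂] at d1 d2
  rw [← key, ← key] at d1 d2
  have e1 := (abs_le.1 d1).2
  have e2 := (abs_le.1 d2).2
  -- find the pair
  obtain ⟨a, a', haZ, ha'Z, hne, hC1, hC2⟩ : ∃ a a', a ∈ Z ∧ a' ∈ Z ∧ a ≠ a' ∧
      Conn E w₁ l₁ L a a' ∧ Conn E w₂ l₂ L a' a := by
    by_contra hcon
    push Not at hcon
    let Q₁ := (Z ×ˢ Z).filter (fun p => ¬ Conn E w₁ l₁ L p.1 p.2)
    let Q₂ := (Z ×ˢ Z).filter (fun p => ¬ Conn E w₂ l₂ L p.1 p.2)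
    have hsub : Z ×ˢ Z ⊆ (Q₁ ∪ Q₂.image Prod.swap) ∪ Finset.univ.image (fun a : Fin n => (a, a)) := by
      rintro ⟨a, a'⟩ hp
      rw [Finset.mem_product] at hp
      by_cases hne : a = a'
      · exact Finset.mem_union_right _ (Finset.mem_image.2 ⟨a, by simp, by simp [hne]⟩)
      apply Finset.mem_union_left
      by_cases h1 : Conn E w₁ l₁ L a a'
      · apply Finset.mem_union_right
        refine Finset.mem_image.2 ⟨(a', a), ?_, rfl⟩
        simp only [Q₂, Finset.mem_filter, Finset.mem_product]
        exact ⟨⟨hp.2, hp.1⟩, hcon a a' hp.1 hp.2 hne h1⟩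
      · apply Finset.mem_union_left
        simp only [Q₁, Finset.mem_filter, Finset.mem_product]
        exact ⟨hp, h1⟩
    have hle : Z.card * Z.card ≤ Q₁.card + Q₂.card + n := by
      rw [← Finset.card_product]
      refine (Finset.card_le_card hsub).trans ((Finset.card_union_le _ _).trans ?_)
      refine Nat.add_le_add ((Finset.card_union_le _ _).trans
        (Nat.add_le_add_left Finset.card_image_le _)) (Finset.card_image_le.trans (by simp))
    have hle' : (Z.card : ℝ) * Z.card ≤ Q₁.card + Q₂.card + n := by exact_mod_cast hle
    have hz := hdeg z
    rw [← hZ] at hz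
    have hzz : (ε * n) * (ε * n) ≤ (Z.card : ℝ) * Z.card :=
      mul_self_le_mul_self (by positivity) hz
    have hnn : (2 : ℝ) < n * ε ^ 2 := by
      rwa [div_lt_iff₀ (by positivity)] at hnbig
    have h1 : (Q₁.card : ℝ) ≤ 2 * (ε ^ 2 / 16 * (n : ℝ) ^ 2) := by
      have g1 : (Q₁.card : ℝ) ≤ η * (n : ℝ) ^ 2 + η * (n : ℝ) ^ 2 := by
        refine le_trans ?_ (add_le_add e1 b1)
        refine le_trans (le_of_eq ?_) (le_of_eq (sub_add_cancel _ _).symm)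
        congr
      rw [hηd] at g1
      linarith
    have h2 : (Q₂.card : ℝ) ≤ 2 * (ε ^ 2 / 16 * (n : ℝ) ^ 2) := by
      have g1 : (Q₂.card : ℝ) ≤ η * (n : ℝ) ^ 2 + η * (n : ℝ) ^ 2 := by
        refine le_trans ?_ (add_le_add e2 b2)
        refine le_trans (le_of_eq ?_) (le_of_eq (sub_add_cancel _ _).symm)
        congr
      rw [hηd] at g1
      linarith
    have h3 : 2 * (n : ℝ) < n * ε ^ 2 * n := by nlinarith
    nlinarith
  obtain ⟨q₁, hq₁, hq₁a, hq₁a', hq₁F⟩ := hC1 {a, a'} (Finset.card_le_two.trans (by omega))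
  obtain ⟨q₂, hq₂, hq₂a, hq₂a', hq₂F⟩ := hC2 ({a, a'} ∪ (Finset.range (l₁ + 1)).image q₁) (by
    refine (Finset.card_union_le _ _).trans ?_
    have h1 : ({a, a'} : Finset (Fin n)).card ≤ 2 := Finset.card_le_two
    have h2 : ((Finset.range (l₁ + 1)).image q₁).card ≤ l₁ + 1 :=
      Finset.card_image_le.trans (by simp)
    omega)
  refine ⟨a, a', q₁, q₂, hne, hq₁, hq₂, hq₁a, hq₁a', hq₂a, hq₂a', ?_, ?_, ?_⟩
  · intro t ht
    have := hq₁F t ht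
    simpa [not_or] using this
  · intro t ht
    have := hq₂F t ht
    simp only [Finset.mem_union, Finset.mem_insert, Finset.mem_singleton, not_or] at this
    exact this.1
  · intro s hs t ht heq
    refine hq₂F t ht (Finset.mem_union_right _ (Finset.mem_image.2 ⟨s, by simp; omega, heq⟩))

open Classical in
lemma cover_lemma (ε : ℝ) (hε1 : ε ≤ 1) (n : ℕ) (E : Fin n → Fin n → Prop)
    (hn : 0 < n) (hdeg : ∀ z, ε * n ≤ ((inN E z).card : ℝ)) (j : ℕ) :
    ∃ U : Finset (Fin n), U.card ≤ j ∧
      ((Finset.univ.filter (fun a => ∀ u ∈ U, ¬ E u a)).card : ℝ) ≤ (1 - ε) ^ j * n := by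
  have hn' : (0 : ℝ) < n := by exact_mod_cast hn
  induction j with
  | zero => exact ⟨∅, by simp, by simp⟩
  | succ j ih =>
    obtain ⟨U, hU, hUc⟩ := ih
    set A := Finset.univ.filter (fun a => ∀ u ∈ U, ¬ E u a) with hA
    have hsum : ∑ _u : Fin n, ε * (A.card : ℝ) ≤ ∑ u : Fin n, ((A.filter (fun a => E u a)).card : ℝ) := by
      have h1 : ∑ u : Fin n, ((A.filter (fun a => E u a)).card : ℝ) =
          ∑ a ∈ A, ((inN E a).card : ℝ) := by
        simp only [Finset.card_filter, inN, Nat.cast_sum]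
        rw [Finset.sum_comm]
      rw [h1]
      have h2 := Finset.card_nsmul_le_sum A _ _ (fun a _ => hdeg a)
      refine le_trans (le_of_eq ?_) h2
      simp
      ring
    obtain ⟨u, -, hu⟩ := Finset.exists_le_of_sum_le (⟨⟨0, hn⟩, Finset.mem_univ _⟩) hsum
    refine ⟨insert u U, (Finset.card_insert_le _ _).trans (by omega), ?_⟩
    have h3 : Finset.univ.filter (fun a => ∀ v ∈ insert u U, ¬ E v a) =
        A.filter (fun a => ¬ E u a) := by
      ext a
      simp [hA]
      tauto
    have h4 : ((A.filter (fun a => E u a)).card : ℝ) + ((A.filter (fun a => ¬ E u a)).card : ℝ) = A.card := by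
      exact_mod_cast Finset.card_filter_add_card_filter_not (s := A) (fun a => E u a)
    rw [h3, pow_succ]
    have : (1 - ε) * (A.card : ℝ) ≤ (1 - ε) * ((1 - ε) ^ j * n) :=
      mul_le_mul_of_nonneg_left hUc (by linarith)
    linarith

open Classical in
lemma alpha_main (ε : ℝ) (hε : 0 < ε) (l : ℕ) (w : ℕ → Bool) : ∃ c : ℕ, ∀ (n : ℕ)
    (E : Fin n → Fin n → Prop), (∀ v, ¬ E v v) → (∀ z, ε * n ≤ ((inN E z).card : ℝ)) →
    ¬ Col E Set.univ c →
    ∃ u a a' q, a ≠ a' ∧ u ≠ a ∧ u ≠ a' ∧ WPath E w l q ∧ E u a ∧ E u a' ∧ E a (q 0) ∧ E a' (q l) ∧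
      (∀ t ≤ l, q t ≠ u ∧ q t ≠ a ∧ q t ≠ a') := by
  rcases lt_or_ge 1 ε with h1 | hε1
  · refine ⟨0, ?_⟩
    intro n E hE hdeg hcol
    exfalso
    rcases Nat.eq_zero_or_pos n with rfl | hn
    · exact hcol ⟨fun _ => 0, fun v => v.elim0, fun v => v.elim0⟩
    · have h2 := hdeg ⟨0, hn⟩
      have h3 : ((inN E ⟨0, hn⟩).card : ℝ) ≤ n := by
        exact_mod_cast (Finset.card_le_univ _).trans (by simp)
      have hn' : (0 : ℝ) < n := by exact_mod_cast hn
      nlinarith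
  obtain ⟨j, hj⟩ : ∃ j : ℕ, (1 - ε) ^ j < ε / 2 :=
    exists_pow_lt_of_lt_one (by positivity) (by linarith)
  obtain ⟨c₁, hc₁⟩ := noStart_col l
  refine ⟨j * (c₁ + 1) + ⌈2 * j * (l + 3) / ε⌉₊, ?_⟩
  intro n E hE hdeg hcol
  have hnbig : 2 * j * (l + 3) / ε < n := by
    by_contra hcon
    push Not at hcon
    apply hcol
    have h1 : n ≤ ⌈2 * j * (l + 3) / ε⌉₊ := by
      have := hcon.trans (Nat.le_ceil _)
      exact_mod_cast this
    refine (Col.finset hE (Finset.univ : Finset (Fin n))).mono (by simp) ?_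
    simp; omega
  have hn' : (0 : ℝ) < n := lt_of_le_of_lt (by positivity) hnbig
  have hn : 0 < n := by exact_mod_cast hn'
  obtain ⟨U, hUj, hU⟩ := cover_lemma ε hε1 n E hn hdeg j
  have htype : ∀ z, ∃ u ∈ U, l + 3 ≤ ((inN E z).filter (fun a => E u a)).card := by
    intro z
    by_contra hcon
    push Not at hcon
    have hsub : inN E z ⊆ Finset.univ.filter (fun a => ∀ u ∈ U, ¬ E u a) ∪
        U.biUnion (fun u => (inN E z).filter (fun a => E u a)) := by
      intro a ha
      by_cases h : ∀ u ∈ U, ¬ E u a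
      · exact Finset.mem_union_left _ (by simpa using h)
      · push Not at h
        obtain ⟨u, hu, hua⟩ := h
        exact Finset.mem_union_right _ (Finset.mem_biUnion.2 ⟨u, hu, by simp [ha, hua]⟩)
    have h1 : (inN E z).card ≤ (Finset.univ.filter (fun a => ∀ u ∈ U, ¬ E u a)).card + j * (l + 3) := by
      refine (Finset.card_le_card hsub).trans ((Finset.card_union_le _ _).trans ?_)
      refine Nat.add_le_add_left ?_ _
      refine (Finset.card_biUnion_le_card_mul _ _ (l + 3) fun u hu => (hcon u hu).le).trans ?_
      exact Nat.mul_le_mul_right _ hUj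
    have h2 : ((inN E z).card : ℝ) ≤
        ((Finset.univ.filter (fun a => ∀ u ∈ U, ¬ E u a)).card : ℝ) + j * (l + 3) := by
      exact_mod_cast h1
    have h3 := hdeg z
    have h4 : (1 - ε) ^ j * n < ε / 2 * n := by gcongr
    rw [div_lt_iff₀ hε] at hnbig
    nlinarith
  choose u huU hu using htype
  let e := U.equivFin
  obtain ⟨i, hi⟩ : ∃ i, ¬ Col E {v ∈ Set.univ | e ⟨u v, huU v⟩ = i} (c₁ + 1) := by
    by_contra hcon
    push Not at hcon
    apply hcol
    refine (Col.types (fun v => e ⟨u v, huU v⟩) hcon).mono le_rfl ?_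
    have := Nat.mul_le_mul_right (c₁ + 1) hUj
    omega
  set x : Fin n := (e.symm i : Fin n) with hx
  set W := {v ∈ Set.univ | e ⟨u v, huU v⟩ = i} \ ((({x} : Finset (Fin n))) : Set (Fin n)) with hW
  have hcol2 : ¬ Col E W c₁ := Col.not_diff hE {x} (R := 1) (by simp) hi
  obtain ⟨z, hzW, hz⟩ : ∃ z ∈ W, z ∉ NoStart E w l W := by
    by_contra hcon
    push Not at hcon
    exact hcol2 ((hc₁ w _ E hE W).mono hcon le_rfl)
  have hp : ∃ q, WPath E w l q ∧ q 0 = z ∧ ∀ t ≤ l, q t ∈ W := by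
    by_contra hcon
    exact hz ⟨hzW, hcon⟩
  obtain ⟨q, hq, -, hqW⟩ := hp
  have hWu : ∀ v ∈ W, v ≠ x ∧ u v = x := by
    intro v hv
    simp only [hW, Set.mem_sdiff, Set.mem_ofPred_eq, Set.mem_univ, true_and, Finset.coe_singleton,
      Set.mem_singleton_iff] at hv
    refine ⟨hv.2, ?_⟩
    rw [hx, ← hv.1]
    simp
  have hpick : ∀ (v : Fin n) (F : Finset (Fin n)), v ∈ W → F.card < l + 3 →
      ∃ a, E x a ∧ E a v ∧ a ∉ F := by
    intro v F hv hF
    have h1 := hu v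
    rw [(hWu v hv).2] at h1
    obtain ⟨a, ha, haF⟩ := Finset.exists_mem_notMem_of_card_lt_card (hF.trans_le h1)
    simp only [Finset.mem_filter, mem_inN] at ha
    exact ⟨a, ha.2, ha.1, haF⟩
  have hcardq : ((Finset.range (l + 1)).image q).card ≤ l + 1 :=
    Finset.card_image_le.trans (by simp)
  obtain ⟨a, hxa, ha0, haF⟩ := hpick (q 0) ((Finset.range (l + 1)).image q) (hqW 0 (by omega)) (by omega)
  obtain ⟨a', hxa', hal, ha'F⟩ := hpick (q l) (insert a ((Finset.range (l + 1)).image q))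
    (hqW l le_rfl) ((Finset.card_insert_le _ _).trans_lt (by omega))
  refine ⟨x, a, a', q, ?_, ?_, ?_, hq, hxa, hxa', ha0, hal, ?_⟩
  · rintro rfl
    exact ha'F (Finset.mem_insert_self _ _)
  · rintro h
    rw [← h] at hxa
    exact hE _ hxa
  · rintro h
    rw [← h] at hxa'
    exact hE _ hxa'
  · intro t ht
    have hm : q t ∈ (Finset.range (l + 1)).image q := Finset.mem_image.2 ⟨t, by simp; omega, rfl⟩
    refine ⟨(hWu _ (hqW t ht)).1, ?_, ?_⟩
    · rintro rfl; exact haF hm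
    · rintro rfl; exact ha'F (Finset.mem_insert_of_mem hm)

end MainTools


/-- Gluing a closed pattern into a copy of the oriented cycle. -/
lemma glue_cycle {k : ℕ} (hk : 2 ≤ k) (o : ZMod k → Bool) {V : Type} (E : V → V → Prop)
    (i : ZMod k) (p : ℕ → V) (hinj : ∀ s t, s < k → t < k → p s = p t → s = t)
    (harc : ∀ t, t + 1 < k → darc E (o (i + (t : ℕ))) (p t) (p (t + 1)))
    (hlast : darc E (o (i + ((k - 1 : ℕ) : ZMod k))) (p (k - 1)) (p 0)) :
    ContainsDigraph E (cycleOrient o) := by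
  have : NeZero k := ⟨by omega⟩
  have key : ∀ u : ZMod k, darc E (o u) (p (u - i).val) (p (u + 1 - i).val) := by
    intro u
    have hlt := ZMod.val_lt (u - i)
    have hu : i + ((u - i).val : ZMod k) = u := by
      rw [ZMod.natCast_zmod_val]; ring
    have hu1 : u + 1 - i = (((u - i).val + 1 : ℕ) : ZMod k) := by
      push_cast
      rw [ZMod.natCast_zmod_val]; ring
    by_cases h : (u - i).val + 1 < k
    · have := harc _ h
      rw [hu] at this
      rwa [hu1, ZMod.val_natCast_of_lt h]
    · have h1 : (u - i).val = k - 1 := by omega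
      have h2 : (u - i).val + 1 = k := by omega
      rw [hu1, h2, h1]
      rw [h1] at hu
      rw [hu] at hlast
      simpa using hlast
  refine ⟨fun z => p (z - i).val, ?_, ?_⟩
  · intro x y hxy
    have := hinj _ _ (ZMod.val_lt _) (ZMod.val_lt _) hxy
    have := ZMod.val_injective k this
    simpa using this
  · rintro u v (⟨h, rfl⟩ | ⟨h, rfl⟩)
    · have := key u
      simpa [h, darc] using this
    · have := key v
      simpa [h, darc] using this

/-- Indices at which the orientation changes from backward to forward. -/
def FTset {k : ℕ} [NeZero k] (o : ZMod k → Bool) : Finset (ZMod k) :=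
  Finset.univ.filter (fun i => o i = false ∧ o (i + 1) = true)

/-- Indices at which the orientation changes from forward to backward. -/
def TFset {k : ℕ} [NeZero k] (o : ZMod k → Bool) : Finset (ZMod k) :=
  Finset.univ.filter (fun i => o i = true ∧ o (i + 1) = false)

lemma FT_eq_TF {k : ℕ} [NeZero k] (o : ZMod k → Bool) :
    (FTset o).card = (TFset o).card := by
  have h1 : (Finset.univ.filter (fun i : ZMod k => o (i + 1) = true)).card =
      (Finset.univ.filter (fun i : ZMod k => o i = true)).card := by
    refine Finset.card_bij (fun i _ => i + 1) ?_ ?_ ?_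
    · intro a ha; simpa using ha
    · intro a _ b _ h; simpa using h
    · intro b hb
      exact ⟨b - 1, by simpa using hb, by simp⟩
  have h2 := Finset.card_filter_add_card_filter_not
    (s := Finset.univ.filter (fun i : ZMod k => o (i + 1) = true)) (fun i => o i = true)
  have h3 := Finset.card_filter_add_card_filter_not
    (s := Finset.univ.filter (fun i : ZMod k => o i = true)) (fun i => o (i + 1) = true)
  rw [Finset.filter_filter, Finset.filter_filter] at h2 h3
  have e1 : Finset.univ.filter (fun i : ZMod k => o (i + 1) = true ∧ o i = true) =
      Finset.univ.filter (fun i : ZMod k => o i = true ∧ o (i + 1) = true) := by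
    ext; simp [and_comm]
  have e2 : Finset.univ.filter (fun i : ZMod k => o (i + 1) = true ∧ ¬ o i = true) = FTset o := by
    ext; simp [FTset, and_comm]
  have e3 : Finset.univ.filter (fun i : ZMod k => o i = true ∧ ¬ o (i + 1) = true) = TFset o := by
    ext; simp [TFset]
  rw [e1, e2] at h2
  rw [e3] at h3
  omega

lemma const_of_step {k : ℕ} [NeZero k] (o : ZMod k → Bool) (h : ∀ i, o i = o (i + 1)) :
    ∀ i, o i = o 0 := by
  have : ∀ t : ℕ, o (t : ZMod k) = o 0 := by
    intro t
    induction t with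
    | zero => simp
    | succ t ih => rw [← ih, h (t : ZMod k)]; push_cast; rfl
  intro i
  rw [← this i.val, ZMod.natCast_zmod_val]

lemma blockCount_nonconst {k : ℕ} [NeZero k] (o : ZMod k → Bool) (h : ¬ ∀ i, o i = o 0) :
    blockCount o = 2 * (FTset o).card ∧ 1 ≤ (FTset o).card := by
  have hdis : Disjoint (FTset o) (TFset o) := by
    rw [Finset.disjoint_left]
    intro a ha hb
    simp [FTset, TFset] at ha hb
    simp [ha.1] at hb
  have hset : {i : ZMod k | o i ≠ o (i + 1)} = ((FTset o ∪ TFset o : Finset (ZMod k)) : Set (ZMod k)) := by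
    ext i
    simp only [FTset, TFset, Set.mem_ofPred_eq, Finset.coe_union, Set.mem_union, Finset.coe_filter, Finset.mem_univ, true_and]
    cases o i <;> cases o (i + 1) <;> simp
  have hb : blockCount o = 2 * (FTset o).card := by
    unfold blockCount
    rw [if_neg h, hset, Set.ncard_coe_finset, Finset.card_union_of_disjoint hdis, ← FT_eq_TF]
    ring
  refine ⟨hb, ?_⟩
  by_contra hlt
  have h0 : (FTset o).card = 0 := by omega
  have h0' := FT_eq_TF o
  rw [h0] at h0'
  rw [Finset.card_eq_zero] at h0
  have h0'' := Finset.card_eq_zero.1 h0'.symm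
  apply h
  apply const_of_step
  intro i
  by_contra hi
  have : i ∈ {i : ZMod k | o i ≠ o (i + 1)} := hi
  rw [hset, h0, h0''] at this
  simp at this

/-- The pattern with two distinct sources. -/
lemma three_blocks {k : ℕ} [NeZero k] (o : ZMod k → Bool) (h : 3 ≤ blockCount o) :
    ∃ (i : ZMod k) (d : ℕ), 2 ≤ d ∧ d + 2 ≤ k ∧ o i = true ∧ o (i - 1) = false ∧
      o (i + (d : ℕ)) = true ∧ o (i + (d : ℕ) - 1) = false := by
  have hnc : ¬ ∀ i, o i = o 0 := by
    intro hc
    unfold blockCount at h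
    rw [if_pos hc] at h
    omega
  obtain ⟨hb, _⟩ := blockCount_nonconst o hnc
  have h2 : 1 < (FTset o).card := by omega
  obtain ⟨i', hi', j', hj', hne⟩ := Finset.one_lt_card.1 h2
  simp only [FTset, Finset.mem_filter, Finset.mem_univ, true_and] at hi' hj'
  have hlt := ZMod.val_lt (j' - i')
  have hj : i' + ((j' - i').val : ZMod k) = j' := by
    rw [ZMod.natCast_zmod_val]; ring
  have e1 : i' + 1 + ((j' - i').val : ZMod k) = j' + 1 := by
    rw [← hj]; simp; ring
  refine ⟨i' + 1, (j' - i').val, ?_, ?_, hi'.2, by simpa using hi'.1, ?_, ?_⟩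
  · by_contra hcon
    have : (j' - i').val = 0 ∨ (j' - i').val = 1 := by omega
    rcases this with h0 | h0
    · rw [h0] at hj
      simp at hj
      exact hne hj
    · rw [h0] at hj
      simp at hj
      rw [hj] at hi'
      simp [hj'.1] at hi'
  · by_contra hcon
    have h0 : (j' - i').val = k - 1 := by omega
    have : j' + 1 = i' := by
      rw [← hj, h0, add_assoc]
      have : ((k - 1 : ℕ) : ZMod k) + 1 = ((k - 1 + 1 : ℕ) : ZMod k) := by push_cast; rfl
      rw [this, show k - 1 + 1 = k by omega]
      simp
    rw [this] at hj'
    simp [hi'.1] at hj'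
  · rw [e1]; exact hj'.2
  · rw [e1]; simpa using hj'.1

lemma two_blocks {k : ℕ} (hk : 2 ≤ k) [NeZero k] (o : ZMod k → Bool) (h : blockCount o = 2)
    (hs : ¬ hasShortBlock o) :
    4 ≤ k ∧ ∃ i : ZMod k, o i = true ∧ o (i + 1) = true ∧ o (i - 1) = false ∧ o (i - 2) = false := by
  have hnc : ¬ ∀ i, o i = o 0 := by
    intro hc
    unfold blockCount at h
    rw [if_pos hc] at h
    omega
  obtain ⟨hb, _⟩ := blockCount_nonconst o hnc
  have h2 : 0 < (FTset o).card := by omega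
  obtain ⟨i, hi⟩ := Finset.card_pos.1 h2
  simp only [FTset, Finset.mem_filter, Finset.mem_univ, true_and] at hi
  have h3 : o (i + 2) = true := by
    by_contra hc
    exact hs ⟨i, by simp [hi], by rw [hi.2]; exact fun e => hc e.symm⟩
  have h4 : o (i - 1) = false := by
    by_contra hc
    refine hs ⟨i - 1, ?_, ?_⟩
    · rw [show i - 1 + 1 = i by ring, hi.1]; exact hc
    · rw [show i - 1 + 1 = i by ring, show i - 1 + 2 = i + 1 by ring, hi.1, hi.2]; simp
  refine ⟨?_, i + 1, hi.2, by rw [← h3]; congr 1; ring, by simpa using hi.1,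
    by rw [← h4]; congr 1; ring⟩
  by_contra hcon
  have hk' : k = 2 ∨ k = 3 := by omega
  rcases hk' with rfl | rfl
  · have : i - 1 = i + 1 := (by decide : ∀ i : ZMod 2, i - 1 = i + 1) i
    rw [this] at h4
    simp [hi.2] at h4
  · have : i - 1 = i + 2 := (by decide : ∀ i : ZMod 3, i - 1 = i + 2) i
    rw [this] at h4
    simp [h3] at h4

lemma not_col_of_chromatic {n : ℕ} (E : Fin n → Fin n → Prop) (c : ℕ)
    (h : ((c + 1 : ℕ) : ℕ∞) ≤ (SimpleGraph.fromRel E).chromaticNumber) :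
    ¬ Col E Set.univ c := by
  rintro ⟨f, hf, hE⟩
  have hcol : (SimpleGraph.fromRel E).Colorable c := by
    refine ⟨SimpleGraph.Coloring.mk (fun v => (⟨f v, hf v trivial⟩ : Fin c)) ?_⟩
    intro u v huv
    rw [SimpleGraph.fromRel_adj] at huv
    intro he
    simp only [Fin.mk.injEq] at he
    rcases huv.2 with h1 | h1
    · exact hE u trivial v trivial h1 he
    · exact hE v trivial u trivial h1 he.symm
  have := h.trans (SimpleGraph.chromaticNumber_le_iff_colorable.2 hcol)
  have : c + 1 ≤ c := by exact_mod_cast this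
  omega

lemma card_inN {n : ℕ} (E : Fin n → Fin n → Prop) (v : Fin n) :
    Nat.card {u : Fin n // E u v} = (inN E v).card := by
  classical
  rw [Nat.card_eq_fintype_card, Fintype.card_subtype]
  congr 1

theorem forward_dir {k : ℕ} (hk : 2 ≤ k) (o : ZMod k → Bool)
    (h : 3 ≤ blockCount o ∨ (blockCount o = 2 ∧ ¬ hasShortBlock o)) (ε : ℝ) (hε : 0 < ε) :
    ∃ c : ℕ, 1 ≤ c ∧
        ∀ (n : ℕ) (E : Fin n → Fin n → Prop), (∀ v, ¬ E v v) →
          (c : ℕ∞) ≤ (SimpleGraph.fromRel E).chromaticNumber →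
          (∀ v : Fin n, ε * (n : ℝ) ≤ (Nat.card {u : Fin n // E u v} : ℝ)) →
          ContainsDigraph E (cycleOrient o) := by
  have : NeZero k := ⟨by omega⟩
  rcases h with h | ⟨h, hs⟩
  · obtain ⟨i, d, hd2, hdk, h1, h2, h3, h4⟩ := three_blocks o h
    obtain ⟨c, hc⟩ := beta_main ε hε (d - 2) (k - d - 2) (fun t => o (i + 1 + (t : ℕ)))
      (fun t => o (i + (d : ℕ) + 1 + (t : ℕ)))
    refine ⟨c + 1, by omega, fun n E hE hχ hdeg => ?_⟩
    obtain ⟨a, a', q₁, q₂, haa, hq₁, hq₂, e1, e2, e3, e4, n1, n2, n3⟩ :=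
      hc n E hE (fun z => by rw [← card_inN]; exact hdeg z) (not_col_of_chromatic E c hχ)
    let p : ℕ → Fin n := fun t => if t = 0 then a else if t < d then q₁ (t - 1) else
      if t = d then a' else q₂ (t - d - 1)
    have p0 : p 0 = a := by simp [p]
    have p1 : ∀ t, 1 ≤ t → t < d → p t = q₁ (t - 1) := by
      intro t h1 h2
      simp only [p]; rw [if_neg (by omega), if_pos h2]
    have pd : p d = a' := by
      simp only [p]; rw [if_neg (by omega), if_neg (by omega), if_pos trivial]
    have p2 : ∀ t, d < t → p t = q₂ (t - d - 1) := by
      intro t h1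
      simp only [p]; rw [if_neg (by omega), if_neg (by omega), if_neg (by omega)]
    have split : ∀ t, t = 0 ∨ (1 ≤ t ∧ t < d) ∨ t = d ∨ d < t := by intro t; omega
    refine glue_cycle hk o E i p ?_ ?_ ?_
    · have main : ∀ s t, s < t → t < k → p s ≠ p t := by
        intro s t hst htk
        rcases split s with rfl | ⟨hs1, hs2⟩ | rfl | hs
        · rw [p0]
          rcases split t with rfl | ⟨ht1, ht2⟩ | rfl | ht
          · omega
          · rw [p1 t ht1 ht2]; exact (n1 _ (by omega)).1.symm
          · rw [pd]; exact haa
          · rw [p2 t ht]; exact (n2 _ (by omega)).1.symm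
        · rw [p1 s hs1 hs2]
          rcases split t with rfl | ⟨ht1, ht2⟩ | rfl | ht
          · omega
          · rw [p1 t ht1 ht2]
            intro he
            have := hq₁.inj _ _ (by omega) (by omega) he
            omega
          · rw [pd]; exact (n1 _ (by omega)).2
          · rw [p2 t ht]; exact n3 _ (by omega) _ (by omega)
        · rw [pd, p2 t hst]; exact (n2 _ (by omega)).2.symm
        · rw [p2 s hs, p2 t (by omega)]
          intro he
          have := hq₂.inj _ _ (by omega) (by omega) he
          omega
      intro s t hs ht he
      rcases lt_trichotomy s t with hlt | heq | hlt
      · exact absurd he (main s t hlt ht)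
      · exact heq
      · exact absurd he.symm (main t s hlt hs)
    · intro t ht
      rcases split t with rfl | ⟨ht1, ht2⟩ | rfl | ht1
      · rw [p0, p1 (0 + 1) (by omega) (by omega)]
        simp [darc, h1, e1]
      · rw [p1 t ht1 ht2]
        by_cases hl : t + 1 < d
        · rw [p1 (t + 1) (by omega) hl]
          have := hq₁.arc (t - 1) (by omega)
          rw [show t - 1 + 1 = t + 1 - 1 by omega] at this
          convert this using 2
          rw [show (t : ZMod k) = ((1 + (t - 1) : ℕ) : ZMod k) by congr 1; omega]
          push_cast; ring
        · have hl' : t + 1 = d := by omega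
          have : o (i + (t : ℕ)) = false := by
            rw [← h4, ← hl']; congr 1; push_cast; ring
          rw [this, hl', pd, show t - 1 = d - 2 by omega]
          simp [darc, e2]
      · rw [pd, p2 (t + 1) (by omega), show t + 1 - t - 1 = 0 by omega]
        simp [darc, h3, e3]
      · rw [p2 t ht1, p2 (t + 1) (by omega)]
        have := hq₂.arc (t - d - 1) (by omega)
        rw [show t - d - 1 + 1 = t + 1 - d - 1 by omega] at this
        convert this using 2
        rw [show (t : ZMod k) = ((d + 1 + (t - d - 1) : ℕ) : ZMod k) by congr 1; omega]
        push_cast; ring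
    · have hm : o (i + ((k - 1 : ℕ) : ZMod k)) = false := by
        rw [← h2]; congr 1
        rw [Nat.cast_sub (by omega)]; simp; ring
      rw [hm, p0, p2 (k - 1) (by omega), show k - 1 - d - 1 = k - d - 2 by omega]
      simp [darc, e4]
  · obtain ⟨hk4, i, h1, h2, h3, h4⟩ := two_blocks hk o h hs
    obtain ⟨c, hc⟩ := alpha_main ε hε (k - 4) (fun t => o (i + 2 + (t : ℕ)))
    refine ⟨c + 1, by omega, fun n E hE hχ hdeg => ?_⟩
    obtain ⟨u, a, a', q, haa, hua, hua', hq, e1, e2, e3, e4, n1⟩ :=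
      hc n E hE (fun z => by rw [← card_inN]; exact hdeg z) (not_col_of_chromatic E c hχ)
    let p : ℕ → Fin n := fun t => if t = 0 then u else if t = 1 then a else
      if t = k - 1 then a' else q (t - 2)
    have p0 : p 0 = u := by simp [p]
    have p1 : p 1 = a := by simp [p]
    have pl : p (k - 1) = a' := by
      simp only [p]; rw [if_neg (by omega), if_neg (by omega), if_pos trivial]
    have pq : ∀ t, 2 ≤ t → t < k - 1 → p t = q (t - 2) := by
      intro t h1 h2
      simp only [p]; rw [if_neg (by omega), if_neg (by omega), if_neg (by omega)]
    have split : ∀ t, t < k → t = 0 ∨ t = 1 ∨ (2 ≤ t ∧ t < k - 1) ∨ t = k - 1 := by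
      intro t ht; omega
    refine glue_cycle hk o E i p ?_ ?_ ?_
    · have main : ∀ s t, s < t → t < k → p s ≠ p t := by
        intro s t hst htk
        rcases split s (by omega) with rfl | rfl | ⟨hs1, hs2⟩ | rfl
        · rw [p0]
          rcases split t htk with rfl | rfl | ⟨ht1, ht2⟩ | rfl
          · omega
          · rw [p1]; exact hua
          · rw [pq t ht1 ht2]; exact (n1 _ (by omega)).1.symm
          · rw [pl]; exact hua'
        · rw [p1]
          rcases split t htk with rfl | rfl | ⟨ht1, ht2⟩ | rfl
          · omega
          · omega
          · rw [pq t ht1 ht2]; exact (n1 _ (by omega)).2.1.symm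
          · rw [pl]; exact haa
        · rw [pq s hs1 hs2]
          rcases split t htk with rfl | rfl | ⟨ht1, ht2⟩ | rfl
          · omega
          · omega
          · rw [pq t ht1 ht2]
            intro he
            have := hq.inj _ _ (by omega) (by omega) he
            omega
          · rw [pl]; exact (n1 _ (by omega)).2.2
        · omega
      intro s t hs ht he
      rcases lt_trichotomy s t with hlt | heq | hlt
      · exact absurd he (main s t hlt ht)
      · exact heq
      · exact absurd he.symm (main t s hlt hs)
    · intro t ht
      rcases split t (by omega) with rfl | rfl | ⟨ht1, ht2⟩ | rfl
      · rw [p0, zero_add, p1]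
        simp [darc, h1, e1]
      · rw [p1, pq (1 + 1) (by omega) (by omega)]
        simp [darc, h2, e3]
      · rw [pq t ht1 ht2]
        by_cases hl : t + 1 < k - 1
        · rw [pq (t + 1) (by omega) hl]
          have := hq.arc (t - 2) (by omega)
          rw [show t - 2 + 1 = t + 1 - 2 by omega] at this
          convert this using 2
          rw [show (t : ZMod k) = ((2 + (t - 2) : ℕ) : ZMod k) by congr 1; omega]
          push_cast; ring
        · have hl' : t + 1 = k - 1 := by omega
          have : o (i + (t : ℕ)) = false := by
            rw [← h4, show t = k - 2 by omega]; congr 1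
            rw [Nat.cast_sub (by omega)]; simp; ring
          rw [this, hl', pl, show t - 2 = k - 4 by omega]
          simp [darc, e4]
      · omega
    · have hm : o (i + ((k - 1 : ℕ) : ZMod k)) = false := by
        rw [← h3]; congr 1
        rw [Nat.cast_sub (by omega)]; simp; ring
      rw [hm, p0, pl]
      simp [darc, e2]


lemma shift_ramsey (r : ℕ) : ∀ (K : Type) [Finite K], ∃ N : ℕ, ∀ f : (Fin (r + 1) → ℕ) → K,
    ∃ s : Fin (r + 2) → ℕ, StrictMono s ∧ (∀ i, s i < N) ∧
      f (fun i => s i.castSucc) = f (fun i => s i.succ) := by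
  induction r with
  | zero =>
    intro K _
    refine ⟨Nat.card K + 1, fun f => ?_⟩
    have key : ∃ x y : ℕ, x < y ∧ y < Nat.card K + 1 ∧ f (fun _ => x) = f (fun _ => y) := by
      have hni : ¬ Function.Injective (fun x : Fin (Nat.card K + 1) => f (fun _ => x.val)) := by
        intro hinj
        have := Nat.card_le_card_of_injective _ hinj
        simp at this
      simp only [Function.Injective] at hni
      push Not at hni
      obtain ⟨x, y, hxy, hne⟩ := hni
      rcases lt_or_gt_of_ne hne with h | h
      · exact ⟨x.val, y.val, h, y.2, hxy⟩
      · exact ⟨y.val, x.val, h, x.2, hxy.symm⟩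
    obtain ⟨x, y, hxy, hy, he⟩ := key
    refine ⟨![x, y], ?_, ?_, ?_⟩
    · intro i j hij
      fin_cases i <;> fin_cases j <;> simp_all
    · intro i
      fin_cases i
      · exact hxy.trans hy
      · exact hy
    · convert he using 2
      · ext i; fin_cases i; rfl
      · ext i; fin_cases i; rfl
  | succ r ih =>
    intro K _
    obtain ⟨N, hN⟩ := ih (Set K)
    refine ⟨N, fun f => ?_⟩
    obtain ⟨s, hs, hsN, he⟩ := hN (fun a => {c | ∃ x, x < a 0 ∧ f (Fin.cons x a) = c})
    have hmem : f s ∈ {c | ∃ x, x < s (Fin.succ 0) ∧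
        f (Fin.cons x (fun i => s i.succ) : Fin (r + 2) → ℕ) = c} := by
      refine ⟨s 0, hs (Fin.succ_pos 0), ?_⟩
      congr 1
      exact Fin.cons_self_tail s
    have he' : {c | ∃ x, x < s (Fin.castSucc 0) ∧
        f (Fin.cons x (fun i => s i.castSucc) : Fin (r + 2) → ℕ) = c} = {c | ∃ x, x < s (Fin.succ 0) ∧
        f (Fin.cons x (fun i => s i.succ) : Fin (r + 2) → ℕ) = c} := he
    rw [← he'] at hmem
    obtain ⟨x, hx, hfx⟩ := hmem
    refine ⟨Fin.cons x s, ?_, ?_, ?_⟩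
    · rw [Fin.strictMono_iff_lt_succ]
      intro i
      refine Fin.cases ?_ (fun j => ?_) i
      · exact hx
      · rw [← Fin.succ_castSucc, Fin.cons_succ, Fin.cons_succ]
        exact hs (Fin.castSucc_lt_succ)
    · intro i
      refine Fin.cases ?_ (fun j => ?_) i
      · exact lt_trans hx (hsN _)
      · rw [Fin.cons_succ]; exact hsN j
    · convert hfx using 2
      · ext i
        refine Fin.cases ?_ (fun j => ?_) i
        · rfl
        · rw [← Fin.succ_castSucc, Fin.cons_succ, Fin.cons_succ]
      · funext i
        exact Fin.cons_succ _ _ _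

/-- Increasing windows. -/
abbrev Win (r N : ℕ) : Type := {a : Fin (r + 1) → Fin N // StrictMono a}

/-- Vertices of the counterexample digraph. -/
abbrev Vx (m r N : ℕ) : Type := ((Fin N → Bool) × ZMod m × Win r N) ⊕ Win r N

/-- Arcs of the counterexample digraph. -/
def DE (m r N : ℕ) : Vx m r N → Vx m r N → Prop
  | Sum.inl x, Sum.inl y => y.2.1 = x.2.1 + 1
  | Sum.inl x, Sum.inr b => x.2.1 = 0 ∧ x.1 (b.1 0) = true ∧ x.1 (b.1 (Fin.last r)) = false
  | Sum.inr _, Sum.inl _ => False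
  | Sum.inr a, Sum.inr b => ∀ i j : Fin (r + 1), j.val = i.val + 1 → b.1 i = a.1 j

lemma DE_step {m r N : ℕ} (hr : 1 ≤ r) (a b : Win r N) (h : DE m r N (Sum.inr a) (Sum.inr b)) :
    (a.1 0).val < (b.1 0).val := by
  have := h 0 ⟨1, by omega⟩ (by simp)
  rw [this]
  exact a.2 (Fin.mk_lt_mk.2 (by simp : 0 < 1))

lemma DE_noloop {m r N : ℕ} (hm : 2 ≤ m) (hr : 1 ≤ r) (v : Vx m r N) : ¬ DE m r N v v := by
  rcases v with x | b
  · intro h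
    have h : x.2.1 = x.2.1 + 1 := h
    have h1 : (1 : ZMod m) = 0 := by simpa using h.symm
    have : Fact (1 < m) := ⟨by omega⟩
    exact one_ne_zero h1
  · intro h
    exact lt_irrefl _ (DE_step hr b b h)

lemma DE_not_colorable (m r c : ℕ) : ∃ N, 1 ≤ N ∧
    ∀ f : Vx m r N → Fin c, ∃ u v, DE m r N u v ∧ f u = f v := by
  obtain ⟨N, hN⟩ := shift_ramsey r (Option (Fin c))
  refine ⟨N + 1, by omega, fun f => ?_⟩
  classical
  let g : (Fin (r + 1) → ℕ) → Option (Fin c) := fun a =>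
    if h : (∀ i, a i < N + 1) ∧ StrictMono a then
      some (f (Sum.inr ⟨fun i => ⟨a i, h.1 i⟩, fun i j hij => h.2 hij⟩)) else none
  obtain ⟨s, hs, hsN, he⟩ := hN g
  have h1 : (∀ i : Fin (r + 1), s i.castSucc < N + 1) ∧ StrictMono (fun i : Fin (r + 1) => s i.castSucc) :=
    ⟨fun i => (hsN _).trans (by omega), fun i j hij => hs (by simpa using hij)⟩
  have h2 : (∀ i : Fin (r + 1), s i.succ < N + 1) ∧ StrictMono (fun i : Fin (r + 1) => s i.succ) :=
    ⟨fun i => (hsN _).trans (by omega), fun i j hij => hs (by simpa using hij)⟩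
  simp only [g] at he
  rw [dif_pos h1, dif_pos h2, Option.some_inj] at he
  refine ⟨_, _, ?_, he⟩
  intro i j hij
  apply Fin.ext
  show s i.succ = s j.castSucc
  congr 1
  apply Fin.ext
  simp [hij]

lemma Win_indeg {m r N : ℕ} [NeZero m] (hr : 1 ≤ r) (v : Vx m r N) :
    2 ^ N * Nat.card (Win r N) ≤ 4 * Nat.card {u : Vx m r N // DE m r N u v} := by
  have hc : Nat.card ((Fin N → Bool) × Win r N) = 2 ^ N * Nat.card (Win r N) := by
    rw [Nat.card_prod]; simp
  rw [← hc]
  rcases v with x | b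
  · let F : (Fin N → Bool) × Win r N → {u : Vx m r N // DE m r N u (Sum.inl x)} :=
      fun p => ⟨Sum.inl (p.1, x.2.1 - 1, p.2), by simp [DE]⟩
    have hF : Function.Injective F := by
      rintro ⟨p, q⟩ ⟨p', q'⟩ h
      have h' := Sum.inl.inj (congrArg Subtype.val h)
      simp only [Prod.mk.injEq] at h'
      exact Prod.ext h'.1 h'.2.2
    have := Nat.card_le_card_of_injective F hF
    omega
  · have hne : b.1 0 ≠ b.1 (Fin.last r) := by
      intro h
      have := b.2.injective h
      have := congrArg Fin.val this
      simp at this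
      omega
    let F : (Fin N → Bool) × Win r N → {u : Vx m r N // DE m r N u (Sum.inr b)} × (Bool × Bool) :=
      fun p => ⟨⟨Sum.inl (Function.update (Function.update p.1 (b.1 0) true) (b.1 (Fin.last r)) false, 0, p.2), by
        refine ⟨rfl, ?_, ?_⟩
        · simp [Function.update_of_ne hne]
        · simp⟩, (p.1 (b.1 0), p.1 (b.1 (Fin.last r)))⟩
    have hF : Function.Injective F := by
      rintro ⟨p, q⟩ ⟨p', q'⟩ h
      have h' := Sum.inl.inj (congrArg (fun z => z.1.val) h)
      have h'' := congrArg Prod.snd h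
      simp only [Prod.mk.injEq] at h'
      simp only [F, Prod.mk.injEq] at h''
      obtain ⟨h1, _, h2⟩ := h'
      obtain ⟨h3, h4⟩ := h''
      refine Prod.ext ?_ h2
      funext t
      by_cases t1 : t = b.1 (Fin.last r)
      · rw [t1]; exact h4
      by_cases t0 : t = b.1 0
      · rw [t0]; exact h3
      have := congrFun h1 t
      rwa [Function.update_of_ne t1, Function.update_of_ne t0, Function.update_of_ne t1,
        Function.update_of_ne t0] at this
    have := Nat.card_le_card_of_injective F hF
    rw [Nat.card_prod {u : Vx m r N // DE m r N u (Sum.inr b)}] at this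
    simp at this
    simp
    omega

lemma Vx_card (m r N : ℕ) [NeZero m] :
    Nat.card (Vx m r N) ≤ (m + 1) * (2 ^ N * Nat.card (Win r N)) := by
  have h : Nat.card (Vx m r N) = 2 ^ N * (m * Nat.card (Win r N)) + Nat.card (Win r N) := by
    rw [Nat.card_sum, Nat.card_prod, Nat.card_prod]
    simp
  rw [h]
  have : Nat.card (Win r N) ≤ 2 ^ N * Nat.card (Win r N) :=
    Nat.le_mul_of_pos_left _ (by positivity)
  nlinarith

lemma counter {k : ℕ} (hk : 2 ≤ k) (r : ℕ) (hr : 1 ≤ r) (o : ZMod k → Bool)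
    (h : ∀ N (f : ZMod k → Vx (k + 1) r N),
      (∀ u v, cycleOrient o u v → DE (k + 1) r N (f u) (f v)) → False)
    (h1 : ∀ ε : ℝ, 0 < ε → ∃ c : ℕ, 1 ≤ c ∧
        ∀ (n : ℕ) (E : Fin n → Fin n → Prop), (∀ v, ¬ E v v) →
          (c : ℕ∞) ≤ (SimpleGraph.fromRel E).chromaticNumber →
          (∀ v : Fin n, ε * (n : ℝ) ≤ (Nat.card {u : Fin n // E u v} : ℝ)) →
          ContainsDigraph E (cycleOrient o)) : False := by
  obtain ⟨c, hc1, hc⟩ := h1 (1 / (4 * ((k : ℝ) + 2))) (by positivity)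
  obtain ⟨N, hN1, hN⟩ := DE_not_colorable (k + 1) r c
  have e : Vx (k + 1) r N ≃ Fin (Nat.card (Vx (k + 1) r N)) := Finite.equivFin _
  have hno : ¬ ContainsDigraph (fun u v => DE (k + 1) r N (e.symm u) (e.symm v))
      (cycleOrient o) := by
    rintro ⟨f, _, hf⟩
    exact h N (fun z => e.symm (f z)) hf
  refine hno (hc (Nat.card (Vx (k + 1) r N)) (fun u v => DE (k + 1) r N (e.symm u) (e.symm v))
    (fun v => DE_noloop (by omega) hr _) ?_ ?_)
  · by_contra hlt
    rw [not_le] at hlt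
    have hcol := SimpleGraph.chromaticNumber_le_iff_colorable.1 hlt.le
    obtain ⟨C⟩ := hcol
    obtain ⟨u, v, huv, he⟩ := hN (fun x => C (e x))
    refine C.valid (v := e u) (w := e v) ?_ he
    rw [SimpleGraph.fromRel_adj]
    refine ⟨?_, Or.inl (by simpa using huv)⟩
    intro heq
    have := e.injective heq
    rw [this] at huv
    exact DE_noloop (by omega) hr _ huv
  · intro v
    have h2 := Win_indeg (m := k + 1) hr (e.symm v)
    have h3 := Vx_card (k + 1) r N
    have h4 : Nat.card {u // DE (k + 1) r N (e.symm u) (e.symm v)} =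
        Nat.card {u // DE (k + 1) r N u (e.symm v)} :=
      Nat.card_congr (e.symm.subtypeEquiv (fun a => Iff.rfl))
    rw [h4]
    have h5 : Nat.card (Vx (k + 1) r N) ≤
        (k + 2) * (4 * Nat.card {u // DE (k + 1) r N u (e.symm v)}) :=
      h3.trans (Nat.mul_le_mul_left _ h2)
    have h6 : (Nat.card (Vx (k + 1) r N) : ℝ) ≤
        (k + 2) * (4 * Nat.card {u // DE (k + 1) r N u (e.symm v)}) := by exact_mod_cast h5
    rw [div_mul_eq_mul_div, one_mul, div_le_iff₀ (by positivity)]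
    linarith

lemma B_persist {m r N : ℕ} (hr : 1 ≤ r) (p : ℕ → Vx m r N) (s L : ℕ) (a : Win r N)
    (hs : p s = Sum.inr a) (harc : ∀ t, s ≤ t → t < L → DE m r N (p t) (p (t + 1))) :
    ∀ t, s + t ≤ L → ∃ b : Win r N, p (s + t) = Sum.inr b ∧
      (∀ i j : Fin (r + 1), j.val = i.val + t → b.1 i = a.1 j) ∧
      (a.1 0).val + t ≤ (b.1 0).val := by
  intro t
  induction t with
  | zero =>
    intro _
    refine ⟨a, hs, fun i j hij => ?_, by simp⟩
    rw [show i = j from Fin.ext (by simpa using hij.symm)]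
  | succ t ih =>
    intro hL
    obtain ⟨b, hb, hbs, hb0⟩ := ih (by omega)
    have hd := harc (s + t) (by omega) (by omega)
    rw [hb] at hd
    rcases hp : p (s + t + 1) with x | c
    · rw [hp] at hd
      exact absurd hd (by simp [DE])
    · rw [hp] at hd
      refine ⟨c, rfl, fun i j hij => ?_, ?_⟩
      · have hi : i.val + 1 < r + 1 := by have := j.2; omega
        rw [hd i ⟨i.val + 1, hi⟩ rfl]
        exact hbs _ _ (by simp; omega)
      · have := DE_step hr b c hd
        omega

lemma no_closed {k r N : ℕ} (hk : 2 ≤ k) (hr : 1 ≤ r) (p : ℕ → Vx (k + 1) r N)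
    (harc : ∀ t, DE (k + 1) r N (p t) (p (t + 1))) (hp : ∀ t, p (t + k) = p t) : False := by
  by_cases hB : ∃ s a, p s = Sum.inr a
  · obtain ⟨s, a, hs⟩ := hB
    obtain ⟨b, hb, _, h0⟩ := B_persist hr p s (s + k) a hs (fun t _ _ => harc t) k le_rfl
    rw [hp, hs] at hb
    have := Sum.inr.inj hb
    rw [this] at h0
    omega
  · push Not at hB
    have hA : ∀ t, ∃ y, p t = Sum.inl y := by
      intro t
      rcases h : p t with y | b
      · exact ⟨y, rfl⟩
      · exact absurd h (hB t b)
    choose y hy using hA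
    have hl : ∀ t : ℕ, (y t).2.1 = (y 0).2.1 + (t : ℕ) := by
      intro t
      induction t with
      | zero => simp
      | succ t ih =>
        have := harc t
        rw [hy, hy] at this
        have this : (y (t + 1)).2.1 = (y t).2.1 + 1 := this
        rw [this, ih]; push_cast; ring
    have h1 := hl k
    have h2 := hp 0
    rw [zero_add, hy, hy] at h2
    rw [Sum.inl.inj h2] at h1
    have h3 : ((k : ℕ) : ZMod (k + 1)) = 0 := by simpa using h1.symm
    rw [ZMod.natCast_eq_zero_iff] at h3
    have := Nat.le_of_dvd (by omega) h3
    omega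

lemma no_short {k N : ℕ} (hk : 3 ≤ k) (p : ℕ → Vx (k + 1) (k - 2) N)
    (harc : ∀ t, t + 1 < k → DE (k + 1) (k - 2) N (p t) (p (t + 1)))
    (hsh : DE (k + 1) (k - 2) N (p 0) (p (k - 1))) : False := by
  have hr : 1 ≤ k - 2 := by omega
  have cast0 : ∀ t : ℕ, 0 < t → t < k + 1 → ((t : ℕ) : ZMod (k + 1)) ≠ 0 := by
    intro t h0 h1 h
    rw [ZMod.natCast_eq_zero_iff] at h
    have := Nat.le_of_dvd h0 h
    omega
  rcases h0 : p 0 with x | a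
  · rcases hv : p (k - 1) with z | v
    · -- all in A
      have hl : ∀ t, t ≤ k - 1 → ∃ y, p t = Sum.inl y ∧ y.2.1 = x.2.1 + (t : ℕ) := by
        intro t
        induction t with
        | zero => intro _; exact ⟨x, h0, by simp⟩
        | succ t ih =>
          intro ht
          obtain ⟨y, hy, hyl⟩ := ih (by omega)
          rcases hp : p (t + 1) with y' | b
          · refine ⟨y', rfl, ?_⟩
            have hd := harc t (by omega)
            rw [hy, hp] at hd
            have hd : y'.2.1 = y.2.1 + 1 := hd
            rw [hd, hyl]; push_cast; ring
          · obtain ⟨b', hb', _⟩ := B_persist hr p (t + 1) (k - 1) b hp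
              (fun s _ hs => harc s (by omega)) (k - 1 - (t + 1)) (by omega)
            rw [show t + 1 + (k - 1 - (t + 1)) = k - 1 by omega, hv] at hb'
            exact absurd hb' (by simp)
      obtain ⟨y, hy, hyl⟩ := hl (k - 1) le_rfl
      rw [h0, hy] at hsh
      have hsh : y.2.1 = x.2.1 + 1 := hsh
      rw [hyl] at hsh
      have h1 := add_left_cancel hsh
      rw [show k - 1 = (k - 2) + 1 by omega] at h1
      push_cast at h1
      exact cast0 (k - 2) (by omega) (by omega) (by simpa using h1)
    · rw [h0, hv] at hsh
      obtain ⟨hx0, hT, hF⟩ := hsh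
      rcases h1 : p 1 with x1 | b
      · have hl : ∀ t, 1 ≤ t → t ≤ k - 1 → ∃ y, p t = Sum.inl y ∧ y.2.1 = (t : ℕ) := by
          intro t ht1
          induction t, ht1 using Nat.le_induction with
          | base =>
            intro _
            refine ⟨x1, h1, ?_⟩
            have hd := harc 0 (by omega)
            rw [h0, zero_add, h1] at hd
            have hd : x1.2.1 = x.2.1 + 1 := hd
            rw [hd, hx0]; simp
          | succ t ht1 ih =>
            intro ht
            obtain ⟨y, hy, hyl⟩ := ih (by omega)
            have hd := harc t (by omega)
            rcases hp : p (t + 1) with y' | b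
            · refine ⟨y', rfl, ?_⟩
              rw [hy, hp] at hd
              have hd : y'.2.1 = y.2.1 + 1 := hd
              rw [hd, hyl]; push_cast; ring
            · rw [hy, hp] at hd
              have := hd.1
              rw [hyl] at this
              exact absurd this (cast0 t (by omega) (by omega))
        obtain ⟨y, hy, _⟩ := hl (k - 1) (by omega) le_rfl
        rw [hv] at hy
        simp at hy
      · have hd := harc 0 (by omega)
        rw [h0, zero_add, h1] at hd
        obtain ⟨_, hT', hF'⟩ := hd
        obtain ⟨b', hb', hbs, _⟩ := B_persist hr p 1 (k - 1) b h1
              (fun s _ hs => harc s (by omega)) (k - 2) (by omega)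
        rw [show 1 + (k - 2) = k - 1 by omega, hv] at hb'
        rw [← Sum.inr.inj hb'] at hbs
        rw [hbs 0 (Fin.last _) (by simp)] at hT
        rw [hT] at hF'
        simp at hF'
  · obtain ⟨b, hb, hbs, _⟩ := B_persist hr p 0 (k - 1) a h0
      (fun s _ hs => harc s (by omega)) 1 (by omega)
    rw [zero_add] at hb
    obtain ⟨v, hv, _, hv0⟩ := B_persist hr p 1 (k - 1) b hb
      (fun s _ hs => harc s (by omega)) (k - 2) (by omega)
    rw [show 1 + (k - 2) = k - 1 by omega] at hv
    rw [h0, hv] at hsh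
    have g1 := hsh 0 ⟨1, by omega⟩ (by simp)
    have g2 := hbs 0 ⟨1, by omega⟩ (by simp)
    rw [g1, g2] at hv0
    omega

lemma short_structure {k : ℕ} [NeZero k] (hk : 2 ≤ k) (o : ZMod k → Bool)
    (hnc : ¬ ∀ i, o i = o 0) (hb : blockCount o = 2) (hs : hasShortBlock o) :
    ∃ i : ZMod k, ∀ j, j ≠ i → o j = ! (o i) := by
  obtain ⟨i, h1, h2⟩ := hs
  have hfact : Fact (1 < k) := ⟨by omega⟩
  unfold blockCount at hb
  rw [if_neg hnc] at hb
  have hne : i ≠ i + 1 := by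
    intro h
    have : (1 : ZMod k) = 0 := by simpa using h.symm
    exact one_ne_zero this
  have hset : {i : ZMod k | o i ≠ o (i + 1)} = {i, i + 1} := by
    symm
    apply Set.eq_of_subset_of_ncard_le
    · rintro j (rfl | rfl)
      · exact h1
      · show o (i + 1) ≠ o (i + 1 + 1)
        rwa [show i + 1 + 1 = i + 2 by ring]
    · rw [hb, Set.ncard_pair hne]
    · exact Set.toFinite _
  have hstep : ∀ j, j ≠ i → j ≠ i + 1 → o j = o (j + 1) := by
    intro j hj1 hj2
    by_contra hc
    have : j ∈ {i : ZMod k | o i ≠ o (i + 1)} := hc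
    rw [hset] at this
    rcases this with h | h
    · exact hj1 h
    · exact hj2 h
  have cast0 : ∀ t : ℕ, 0 < t → t < k → ((t : ℕ) : ZMod k) ≠ 0 := by
    intro t h0 h1 h
    rw [ZMod.natCast_eq_zero_iff] at h
    have := Nat.le_of_dvd h0 h
    omega
  have hall : ∀ t : ℕ, t + 1 < k → o (i + 2 + (t : ℕ)) = o (i + 2) := by
    intro t
    induction t with
    | zero => simp
    | succ t ih =>
      intro ht
      rw [← ih (by omega), hstep (i + 2 + (t : ℕ)), Nat.cast_succ, add_assoc (i + 2)]
      · intro h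
        refine cast0 (t + 2) (by omega) (by omega) ?_
        push_cast
        linear_combination h
      · intro h
        refine cast0 (t + 1) (by omega) (by omega) ?_
        push_cast
        linear_combination h
  have h3 : o (i + 2) = ! (o (i + 1)) := by
    revert h2
    cases o (i + 1) <;> cases o (i + 2) <;> simp
  refine ⟨i + 1, fun j hj => ?_⟩
  have hj2 : i + 2 + ((j - (i + 2)).val : ZMod k) = j := by
    rw [ZMod.natCast_zmod_val]; ring
  have hlt := ZMod.val_lt (j - (i + 2))
  by_cases h : (j - (i + 2)).val + 1 < k
  · have := hall _ h
    rw [hj2] at this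
    rw [this, h3]
  · exfalso
    apply hj
    have h4 : (((j - (i + 2)).val + 1 : ℕ) : ZMod k) = 0 := by
      rw [show (j - (i + 2)).val + 1 = k by omega]; simp
    push_cast at h4
    linear_combination h4 - hj2

theorem backward_dir {k : ℕ} (hk : 2 ≤ k) (o : ZMod k → Bool)
    (hC : Function.Injective (cycleArc o))
    (h1 : ∀ ε : ℝ, 0 < ε → ∃ c : ℕ, 1 ≤ c ∧
        ∀ (n : ℕ) (E : Fin n → Fin n → Prop), (∀ v, ¬ E v v) →
          (c : ℕ∞) ≤ (SimpleGraph.fromRel E).chromaticNumber →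
          (∀ v : Fin n, ε * (n : ℝ) ≤ (Nat.card {u : Fin n // E u v} : ℝ)) →
          ContainsDigraph E (cycleOrient o)) :
    3 ≤ blockCount o ∨ (blockCount o = 2 ∧ ¬ hasShortBlock o) := by
  have : NeZero k := ⟨by omega⟩
  by_contra hcon
  push Not at hcon
  obtain ⟨hlt, hsh⟩ := hcon
  by_cases hconst : ∀ i, o i = o 0
  · refine counter hk 1 le_rfl o ?_ h1
    intro N f hf
    rcases hb : o 0 with _ | _
    · refine no_closed hk le_rfl (fun t => f (-(t : ZMod k))) (fun t => ?_) (fun t => by simp)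
      apply hf
      right
      refine ⟨by rw [hconst, hb], by push_cast; ring⟩
    · refine no_closed hk le_rfl (fun t => f (t : ZMod k)) (fun t => ?_) (fun t => by simp)
      apply hf
      left
      refine ⟨by rw [hconst, hb], by push_cast; ring⟩
  · obtain ⟨hbc, hge⟩ := blockCount_nonconst o hconst
    have hb2 : blockCount o = 2 := by omega
    obtain ⟨i, hi⟩ := short_structure hk o hconst hb2 (hsh hb2)
    have hk3 : 3 ≤ k := by
      by_contra h
      have hk2 : k = 2 := by omega
      subst hk2
      have hne : i + 1 ≠ i := (by decide : ∀ i : ZMod 2, i + 1 ≠ i) i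
      have h2 : i + 1 + 1 = i := (by decide : ∀ i : ZMod 2, i + 1 + 1 = i) i
      apply hne
      apply hC
      have h3 := hi _ hne
      unfold cycleArc
      rw [h3, h2]
      cases o i <;> simp
    have cast0 : ∀ t : ℕ, 0 < t → t < k → ((t : ℕ) : ZMod k) ≠ 0 := by
      intro t h0 h1 h
      rw [ZMod.natCast_eq_zero_iff] at h
      have := Nat.le_of_dvd h0 h
      omega
    have hkc : ((k - 1 : ℕ) : ZMod k) = -1 := by
      rw [Nat.cast_sub (by omega)]; simp
    refine counter hk (k - 2) (by omega) o ?_ h1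
    intro N f hf
    rcases hb : o i with _ | _
    · refine no_short hk3 (fun t => f (i + 1 + (t : ZMod k))) (fun t ht => ?_) ?_
      · apply hf
        left
        refine ⟨?_, by push_cast; ring⟩
        rw [hi, hb]; · rfl
        intro h
        refine cast0 (t + 1) (by omega) ht ?_
        push_cast
        linear_combination h
      · apply hf
        right
        rw [hkc]
        refine ⟨by rw [← hb]; congr 1; ring, by simp⟩
    · refine no_short hk3 (fun t => f (i - (t : ZMod k))) (fun t ht => ?_) ?_
      · apply hf
        right
        refine ⟨?_, by push_cast; ring⟩
        rw [hi, hb]; · rfl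
        intro h
        refine cast0 (t + 1) (by omega) ht ?_
        linear_combination -h
      · apply hf
        left
        rw [hkc]
        refine ⟨by rw [← hb]; congr 1; simp, by simp⟩

/-- For `k ≥ 2` and `C` an orientation of the `k`-cycle (given by `o : ZMod k → Bool`,
a genuine digraph without parallel arcs), the following are equivalent: (1) for every
`ε > 0` there is a constant `c ≥ 1` such that every digraph without loops or parallel
arcs with chromatic number at least `c` and minimum **in**-degree at least `ε·|V(D)|`
contains `C` as a subdigraph; (2) `C` consists of at least three blocks, or of exactly
two blocks both of length at least two. -/
theorem orientation_of_cycle_chromatic_threshold_iff_indegree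
    (k : ℕ) (hk : 2 ≤ k) (o : ZMod k → Bool)
    (hC : Function.Injective (cycleArc o)) :
    (∀ ε : ℝ, 0 < ε → ∃ c : ℕ, 1 ≤ c ∧
        ∀ (n : ℕ) (E : Fin n → Fin n → Prop), (∀ v, ¬ E v v) →
          (c : ℕ∞) ≤ (SimpleGraph.fromRel E).chromaticNumber →
          (∀ v : Fin n, ε * (n : ℝ) ≤ (Nat.card {u : Fin n // E u v} : ℝ)) →
          ContainsDigraph E (cycleOrient o)) ↔
      (3 ≤ blockCount o ∨ (blockCount o = 2 ∧ ¬ hasShortBlock o)) := by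
  exact ⟨fun h => backward_dir hk o hC h, fun h ε hε => forward_dir hk o h ε hε⟩
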